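/- arXiv:1703.01203 — 5 statements merged into one kernel-verified Lean document; each statement's English description precedes it below -/
import Mathlib

section
/- Let x_1, …, x_M be i.i.d. random points from the uniform distribution on the unit ball B_n of ℝ^n, let 0 < r < 1, 0 < ϑ < 1, and ρ = √(1−r²). If M < (r/ρ)^n · ( −1 + √(1 + 2ϑρ^n / r^{2n}) ), then with probability greater than 1 − ϑ the set {x_1, …, x_M} is linearly separable. -/
open MeasureTheory ProbabilityTheory

/-- A set `S ⊆ ℝⁿ` is linearly separable if each `x ∈ S` can be strictly separated from the
rest of `S` by a linear functional. -/
def LinearlySeparable {n : ℕ} (S : Set (EuclideanSpace ℝ (Fin n))) : Prop :=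
  ∀ x ∈ S, ∃ l : EuclideanSpace ℝ (Fin n) →ₗ[ℝ] ℝ, ∀ y ∈ S, y ≠ x → l y < l x

/-- An open half of a ball carries at most half of the volume of the ball. -/
theorem two_mul_volume_open_half_closedBall_le {n : ℕ} (c u : EuclideanSpace ℝ (Fin n)) (ρ : ℝ) :
    2 * volume {y | y ∈ Metric.closedBall c ρ ∧ 0 < inner ℝ u (y - c)} ≤
      volume (Metric.closedBall c ρ) := by
  set A : Set (EuclideanSpace ℝ (Fin n)) := {y | y ∈ Metric.closedBall c ρ ∧ 0 < inner ℝ u (y - c)}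
  have hAm : MeasurableSet A :=
    Metric.isClosed_closedBall.measurableSet.inter
      (measurableSet_lt (f := fun _ => (0 : ℝ)) (g := fun y => inner ℝ u (y - c))
        (by fun_prop) (by fun_prop))
  set e : EuclideanSpace ℝ (Fin n) → EuclideanSpace ℝ (Fin n) := fun y => (c + c) - y
  have hmp : MeasurePreserving e volume volume := Measure.measurePreserving_sub_left volume (c + c)
  have hvol : volume (e ⁻¹' A) = volume A := hmp.measure_preimage hAm.nullMeasurableSet
  have hsub (y) : e y - c = -(y - c) := by simp only [e]; abel
  have hdisj : Disjoint A (e ⁻¹' A) := by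
    rw [Set.disjoint_left]
    rintro y ⟨-, hy⟩ ⟨-, hy'⟩
    rw [hsub, inner_neg_right] at hy'
    linarith
  calc 2 * volume A = volume A + volume (e ⁻¹' A) := by rw [hvol, two_mul]
    _ = volume (A ∪ e ⁻¹' A) := (measure_union hdisj (hmp.measurable hAm)).symm
    _ ≤ volume (Metric.closedBall c ρ) := by
      refine measure_mono (Set.union_subset (fun y hy => hy.1) fun y hy => ?_)
      have := hy.1
      rwa [mem_closedBall_iff_norm, hsub, norm_neg, ← mem_closedBall_iff_norm] at this

/-- A cap of the unit ball at height `r` lies in an open half of a ball of radius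
`√(1 - r ^ 2)`. -/
theorem cap_subset_open_half_closedBall {n : ℕ} {r : ℝ} (hr : 0 ≤ r)
    {x : EuclideanSpace ℝ (Fin n)} (hx : x ≠ 0) :
    Metric.closedBall 0 1 ∩ {y | r * ‖x‖ < inner ℝ x y} ⊆
      {y | y ∈ Metric.closedBall ((r / ‖x‖) • x) (√(1 - r ^ 2)) ∧
        0 < inner ℝ x (y - (r / ‖x‖) • x)} := by
  rintro y ⟨hy, hxy⟩
  have hx' : 0 < ‖x‖ := norm_pos_iff.2 hx
  rw [mem_closedBall_zero_iff] at hy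
  simp only [Set.mem_ofPred_eq] at hxy ⊢
  constructor
  · rw [mem_closedBall_iff_norm]
    apply Real.le_sqrt_of_sq_le
    rw [norm_sub_sq_real, inner_smul_right, norm_smul, Real.norm_of_nonneg (by positivity),
      div_mul_cancel₀ _ hx'.ne', real_inner_comm]
    have h1 : r ^ 2 ≤ r / ‖x‖ * inner ℝ x y := by
      calc r ^ 2 = r / ‖x‖ * (r * ‖x‖) := by field_simp
        _ ≤ _ := by gcongr
    have h2 : ‖y‖ ^ 2 ≤ 1 := pow_le_one₀ (norm_nonneg _) hy
    linarith
  · rw [inner_sub_right, inner_smul_right, real_inner_self_eq_norm_sq]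
    have : r / ‖x‖ * ‖x‖ ^ 2 = r * ‖x‖ := by field_simp
    linarith

/-- The uniform measure of the part of the unit ball within distance `r` of the origin. -/
theorem cond_closedBall_norm_le {n : ℕ} {r : ℝ} (hr0 : 0 ≤ r) :
    (volume[|Metric.closedBall (0 : EuclideanSpace ℝ (Fin n)) 1]) {y | ‖y‖ ≤ r} ≤
      ENNReal.ofReal (r ^ n) := by
  rw [cond_apply Metric.isClosed_closedBall.measurableSet]
  rw [mul_comm, ← div_eq_mul_inv]
  refine ENNReal.div_le_of_le_mul ?_
  calc _ ≤ volume (Metric.closedBall (0 : EuclideanSpace ℝ (Fin n)) r) :=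
        measure_mono fun y hy => mem_closedBall_zero_iff.2 hy.2
    _ = _ := by rw [Measure.addHaar_closedBall' volume _ hr0, finrank_euclideanSpace_fin]

/-- The uniform measure of a cap of the unit ball at height `r` is at most
`√(1 - r ^ 2) ^ n / 2`. -/
theorem cond_closedBall_cap_le {n : ℕ} {r : ℝ} (hr : 0 ≤ r) (x : EuclideanSpace ℝ (Fin n)) :
    (volume[|Metric.closedBall (0 : EuclideanSpace ℝ (Fin n)) 1]) {y | r * ‖x‖ < inner ℝ x y} ≤
      ENNReal.ofReal (√(1 - r ^ 2) ^ n / 2) := by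
  rcases eq_or_ne x 0 with rfl | hx
  · simp
  rw [cond_apply Metric.isClosed_closedBall.measurableSet, mul_comm, ← div_eq_mul_inv]
  refine ENNReal.div_le_of_le_mul ?_
  rw [ENNReal.ofReal_div_of_pos two_pos, ENNReal.ofReal_ofNat, div_eq_mul_inv, mul_right_comm,
    ← div_eq_mul_inv, ENNReal.le_div_iff_mul_le (by simp) (by simp), mul_comm]
  calc _ ≤ 2 * volume {y | y ∈ Metric.closedBall ((r / ‖x‖) • x) (√(1 - r ^ 2)) ∧
        0 < inner ℝ x (y - (r / ‖x‖) • x)} := by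
        gcongr
        exact cap_subset_open_half_closedBall hr hx
    _ ≤ volume (Metric.closedBall ((r / ‖x‖) • x) (√(1 - r ^ 2))) :=
        two_mul_volume_open_half_closedBall_le _ _ _
    _ = _ := by
        rw [Measure.addHaar_closedBall' volume _ (Real.sqrt_nonneg _), finrank_euclideanSpace_fin]

/-- If every section `{y | (a, y) ∈ s}` has measure at most `C`, then so has the event that two
distinct coordinates of an i.i.d. sample form a pair in `s`. -/
theorem measure_pi_pair_mem_le {ι α : Type*} [Fintype ι] [MeasurableSpace α] (μ : Measure α)
    [IsProbabilityMeasure μ] {i j : ι} (hij : i ≠ j) {s : Set (α × α)} (hs : MeasurableSet s)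
    {C : ENNReal} (hC : ∀ a, μ (Prod.mk a ⁻¹' s) ≤ C) :
    (Measure.pi fun _ : ι => μ) {x | (x i, x j) ∈ s} ≤ C := by
  have hind : IndepFun (fun x : ι → α => x i) (fun x => x j) (Measure.pi fun _ : ι => μ) :=
    (iIndepFun_pi (μ := fun _ : ι => μ) (X := fun _ => id) fun _ => aemeasurable_id).indepFun hij
  have hmap := (indepFun_iff_map_prod_eq_prod_map_map (measurable_pi_apply i).aemeasurable
    (measurable_pi_apply j).aemeasurable).1 hind
  have hev (k : ι) : (Measure.pi fun _ : ι => μ).map (fun x => x k) = μ :=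
    (measurePreserving_eval (fun _ : ι => μ) k).map_eq
  rw [hev, hev] at hmap
  calc (Measure.pi fun _ : ι => μ) {x | (x i, x j) ∈ s}
      = (μ.prod μ) s := by
        rw [← hmap, Measure.map_apply (by fun_prop) hs]; rfl
    _ = ∫⁻ a, μ (Prod.mk a ⁻¹' s) ∂μ := Measure.prod_apply hs
    _ ≤ ∫⁻ _, C ∂μ := lintegral_mono hC
    _ = C := by simp

/-- Points of norm greater than `r`, none of which lies in the cap at height `r` around another,
form a linearly separable set. -/
theorem linearlySeparable_range_of_inner_le {n : ℕ} {ι : Type*} {r : ℝ} (hr : 0 ≤ r)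
    {x : ι → EuclideanSpace ℝ (Fin n)} (hnorm : ∀ i, r < ‖x i‖)
    (hinner : ∀ i j, i ≠ j → inner ℝ (x i) (x j) ≤ r * ‖x i‖) :
    LinearlySeparable (Set.range x) := by
  rintro _ ⟨i, rfl⟩
  refine ⟨(innerₛₗ ℝ (x i) : _ →ₗ[ℝ] ℝ), ?_⟩
  rintro _ ⟨j, rfl⟩ hne
  have hij : i ≠ j := by rintro rfl; exact hne rfl
  rw [innerₛₗ_apply_apply, innerₛₗ_apply_apply, real_inner_self_eq_norm_sq, sq]
  have := hnorm i
  exact (hinner i j hij).trans_lt (mul_lt_mul_of_pos_right this (hr.trans_lt this))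

/-- The cardinality bound, solved for the failure probability. -/
theorem mul_pow_add_sq_mul_pow_lt {n : ℕ} {m r ρ ϑ : ℝ} (hm : 0 ≤ m) (hr : 0 < r) (hρ : 0 < ρ)
    (h : m < (r / ρ) ^ n * (-1 + √(1 + 2 * ϑ * ρ ^ n / r ^ (2 * n)))) :
    m * r ^ n + m ^ 2 * (ρ ^ n / 2) < ϑ := by
  rw [div_pow, mul_comm 2 n, pow_mul] at h
  have ha : 0 < r ^ n := by positivity
  have hb : 0 < ρ ^ n := by positivity
  generalize r ^ n = a at *
  generalize ρ ^ n = b at *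
  have h1 : m * b / a + 1 < √(1 + 2 * ϑ * b / a ^ 2) := by
    have : m * (b / a) < a / b * (-1 + √(1 + 2 * ϑ * b / a ^ 2)) * (b / a) := by gcongr
    have h2 : a / b * (-1 + √(1 + 2 * ϑ * b / a ^ 2)) * (b / a)
        = -1 + √(1 + 2 * ϑ * b / a ^ 2) := by field_simp
    rw [h2, ← mul_div_assoc] at this
    linarith
  rw [Real.lt_sqrt (by positivity)] at h1
  have h2 : 2 * b / a ^ 2 * (m * a + m ^ 2 * (b / 2)) < 2 * b / a ^ 2 * ϑ := by
    calc _ = (m * b / a + 1) ^ 2 - 1 := by field_simp; ring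
      _ < 2 * ϑ * b / a ^ 2 := by linarith
      _ = _ := by ring
  exact lt_of_mul_lt_mul_left h2 (by positivity)

/-- (Corollary 1, conclusion.) For `x₁, …, x_M` i.i.d. uniform in the unit
ball of `ℝⁿ`, `0 < r, ϑ < 1`, `ρ = √(1 - r²)`: if
`M < (r/ρ)ⁿ(-1 + √(1 + 2ϑρⁿ/r²ⁿ))` then with probability `> 1 - ϑ` the set
`{x₁, …, x_M}` is linearly separable. -/
theorem ball_random_set_linearly_separable
    (n M : ℕ) (hn : 1 ≤ n) (hM : 1 ≤ M)
    (r ϑ : ℝ) (hr0 : 0 < r) (hr1 : r < 1) (hϑ0 : 0 < ϑ) (hϑ1 : ϑ < 1)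
    (ρ : ℝ) (hρ : ρ = Real.sqrt (1 - r ^ 2))
    (μ : Measure (EuclideanSpace ℝ (Fin n)))
    (hμ : μ = volume[|Metric.closedBall (0 : EuclideanSpace ℝ (Fin n)) 1])
    (hcard : (M : ℝ) < (r / ρ) ^ n * (-1 + Real.sqrt (1 + 2 * ϑ * ρ ^ n / r ^ (2 * n)))) :
    (Measure.pi fun _ : Fin M => μ)
      {x : Fin M → EuclideanSpace ℝ (Fin n) | LinearlySeparable (Set.range x)}
      > ENNReal.ofReal (1 - ϑ) := by
  subst hρ
  have hρ0 : 0 < √(1 - r ^ 2) := Real.sqrt_pos.2 (by nlinarith)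
  have hlt := mul_pow_add_sq_mul_pow_lt (Nat.cast_nonneg M) hr0 hρ0 hcard
  have : IsProbabilityMeasure μ := by
    rw [hμ]
    exact cond_isProbabilityMeasure_of_finite
      (Metric.measure_closedBall_pos volume _ one_pos).ne' measure_closedBall_lt_top.ne
  set P := Measure.pi fun _ : Fin M => μ
  set S := {x : Fin M → EuclideanSpace ℝ (Fin n) | LinearlySeparable (Set.range x)}
  set q : ℝ := √(1 - r ^ 2) ^ n / 2
  have hq : 0 ≤ q := by positivity
  have hnorm (i : Fin M) : P {x | ‖x i‖ ≤ r} ≤ ENNReal.ofReal (r ^ n) := by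
    have h := (measurePreserving_eval (fun _ : Fin M => μ) i).measure_preimage
      (s := {y | ‖y‖ ≤ r}) (measurableSet_le (by fun_prop) (by fun_prop)).nullMeasurableSet
    refine h.trans_le ?_
    rw [hμ]
    exact cond_closedBall_norm_le hr0.le
  have hpair (i j : Fin M) :
      P {x | i ≠ j ∧ r * ‖x i‖ < inner ℝ (x i) (x j)} ≤ ENNReal.ofReal q := by
    by_cases hij : i = j
    · simp [hij]
    · simp only [ne_eq, hij, not_false_eq_true, true_and]
      refine measure_pi_pair_mem_le μ hij (s := {p | r * ‖p.1‖ < inner ℝ p.1 p.2})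
        (measurableSet_lt (by fun_prop) (by fun_prop)) fun a => ?_
      rw [hμ]
      exact cond_closedBall_cap_le hr0.le a
  have hsub : Sᶜ ⊆ (⋃ i, {x | ‖x i‖ ≤ r}) ∪
      ⋃ i, ⋃ j, {x | i ≠ j ∧ r * ‖x i‖ < inner ℝ (x i) (x j)} := by
    intro x hx
    by_contra hcon
    simp only [Set.mem_union, Set.mem_iUnion, Set.mem_ofPred_eq, not_or, not_exists, not_and,
      not_le, not_lt] at hcon
    exact hx (linearlySeparable_range_of_inner_le hr0.le hcon.1 hcon.2)
  have hbad : P Sᶜ < ENNReal.ofReal ϑ := by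
    calc P Sᶜ ≤ ∑ i : Fin M, ENNReal.ofReal (r ^ n)
          + ∑ i : Fin M, ∑ j : Fin M, ENNReal.ofReal q := by
          refine (measure_mono hsub).trans ((measure_union_le _ _).trans (add_le_add ?_ ?_))
          · exact (measure_iUnion_fintype_le _ _).trans (Finset.sum_le_sum fun i _ => hnorm i)
          · refine (measure_iUnion_fintype_le _ _).trans (Finset.sum_le_sum fun i _ => ?_)
            exact (measure_iUnion_fintype_le _ _).trans (Finset.sum_le_sum fun j _ => hpair i j)
      _ = ENNReal.ofReal (M * r ^ n + M ^ 2 * q) := by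
          rw [ENNReal.ofReal_add (by positivity) (by positivity),
            ENNReal.ofReal_mul (by positivity), ENNReal.ofReal_mul (by positivity), sq (M : ℝ),
            ENNReal.ofReal_mul (by positivity)]
          simp [mul_assoc]
      _ < ENNReal.ofReal ϑ := (ENNReal.ofReal_lt_ofReal_iff hϑ0).2 hlt
  have hone : 1 ≤ P S + P Sᶜ := by
    calc (1 : ENNReal) = P (S ∪ Sᶜ) := by simp [P]
      _ ≤ _ := measure_union_le _ _
  rw [gt_iff_lt, ENNReal.ofReal_sub _ hϑ0.le, ENNReal.ofReal_one]
  by_contra! hS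
  have hlt1 : ENNReal.ofReal ϑ ≤ 1 := ENNReal.ofReal_le_one.2 hϑ1.le
  have : (1 : ENNReal) < 1 := by
    calc (1 : ENNReal) ≤ P S + P Sᶜ := hone
      _ < (1 - ENNReal.ofReal ϑ) + ENNReal.ofReal ϑ :=
        ENNReal.add_lt_add_of_le_of_lt (measure_ne_top _ _) hS hbad
      _ = 1 := tsub_add_cancel_of_le hlt1
  exact lt_irrefl _ this
end

section
/- Let μ be a product probability measure on the unit cube [0,1]^n whose coordinate marginals have means m_k and variances σ_k², let x̄ = (m_1,…,m_n), R_0² = Σ_k σ_k² > 0, and let x_1, …, x_M be i.i.d. random points with law μ. Then for every 0 < δ < 2/3: P( 1 − δ ≤ ‖x_j − x̄‖²/R_0² ≤ 1 + δ for all j, and ((x_i − x̄)/R_0, (x_M − x̄)/‖x_M − x̄‖) < √(1−δ) for all i ≠ M ) ≥ 1 − 2M·exp(−2δ²R_0⁴/n) − (M−1)·exp(−2R_0⁴(2−3δ)²/n). -/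
open MeasureTheory ProbabilityTheory

/-- **Hoeffding's inequality** on a finite product space: if each `f k` takes values in `[0, 1]`
almost surely, the upper deviation of `∑ k, f k (ω k)` from its mean is sub-Gaussian. -/
lemma measureReal_pi_sum_ge_le {n : ℕ} {Ω : Fin n → Type*} [∀ k, MeasurableSpace (Ω k)]
    (ρ : ∀ k, Measure (Ω k)) [∀ k, IsProbabilityMeasure (ρ k)] {f : ∀ k, Ω k → ℝ}
    (hf : ∀ k, Measurable (f k)) (hf01 : ∀ k, ∀ᵐ ω ∂ρ k, f k ω ∈ Set.Icc (0 : ℝ) 1)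
    {ε : ℝ} (hε : 0 ≤ ε) :
    (Measure.pi ρ).real {ω | ∑ k, ∫ t, f k t ∂ρ k + ε ≤ ∑ k, f k (ω k)}
      ≤ Real.exp (-2 * ε ^ 2 / n) := by
  have hsub : ∀ k ∈ Finset.univ, HasSubgaussianMGF
      (fun ω : ∀ k, Ω k ↦ f k (ω k) - ∫ t, f k t ∂ρ k) ((‖(1 : ℝ) - 0‖₊ / 2) ^ 2)
      (Measure.pi ρ) := by
    intro k _
    refine HasSubgaussianMGF.of_map (Y := fun ω : ∀ k, Ω k ↦ ω k)
      (X := fun t ↦ f k t - ∫ t, f k t ∂ρ k) (measurable_pi_apply k).aemeasurable ?_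
    have hmap := (measurePreserving_eval ρ k).map_eq
    change HasSubgaussianMGF _ _ (Measure.map (Function.eval k) _)
    rw [hmap]
    exact hasSubgaussianMGF_of_mem_Icc (hf k).aemeasurable (hf01 k)
  have hind : iIndepFun (fun k (ω : ∀ k, Ω k) ↦ f k (ω k) - ∫ t, f k t ∂ρ k) (Measure.pi ρ) :=
    iIndepFun_pi (X := fun k t ↦ f k t - ∫ t, f k t ∂ρ k)
      fun k ↦ ((hf k).sub_const _).aemeasurable
  have h := HasSubgaussianMGF.measure_sum_ge_le_of_iIndepFun hind hsub hε
  have hset : {ω : ∀ k, Ω k | ∑ k, ∫ t, f k t ∂ρ k + ε ≤ ∑ k, f k (ω k)}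
      = {ω | ε ≤ ∑ k, (f k (ω k) - ∫ t, f k t ∂ρ k)} := by
    ext ω
    simp only [Set.mem_ofPred_eq, Finset.sum_sub_distrib]
    constructor <;> intro h <;> linarith
  rw [hset]
  refine h.trans_eq ?_
  congr 1
  rcases eq_or_ne n 0 with rfl | hn
  · simp
  · have : (n : ℝ) ≠ 0 := by exact_mod_cast hn
    simp
    field_simp

/-- Lower-tail version of `measureReal_pi_sum_ge_le`. -/
lemma measureReal_pi_sum_le_le {n : ℕ} {Ω : Fin n → Type*} [∀ k, MeasurableSpace (Ω k)]
    (ρ : ∀ k, Measure (Ω k)) [∀ k, IsProbabilityMeasure (ρ k)] {f : ∀ k, Ω k → ℝ}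
    (hf : ∀ k, Measurable (f k)) (hf01 : ∀ k, ∀ᵐ ω ∂ρ k, f k ω ∈ Set.Icc (0 : ℝ) 1)
    {ε : ℝ} (hε : 0 ≤ ε) :
    (Measure.pi ρ).real {ω | ∑ k, f k (ω k) ≤ ∑ k, ∫ t, f k t ∂ρ k - ε}
      ≤ Real.exp (-2 * ε ^ 2 / n) := by
  have h := measureReal_pi_sum_ge_le ρ (f := fun k ω ↦ 1 - f k ω)
    (fun k ↦ measurable_const.sub (hf k))
    (fun k ↦ by
      filter_upwards [hf01 k] with ω hω
      exact ⟨by linarith [hω.2], by linarith [hω.1]⟩) hε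
  have hint : ∀ k, ∫ t, (1 - f k t) ∂ρ k = 1 - ∫ t, f k t ∂ρ k := fun k ↦ by
    rw [integral_sub (integrable_const _) (.of_mem_Icc 0 1 (hf k).aemeasurable (hf01 k))]
    simp
  convert h using 3
  ext ω
  simp only [hint, Finset.sum_sub_distrib]
  constructor <;> intro h <;> linarith

/-- Two distinct coordinates of an i.i.d. tuple with product law, regrouped coordinatewise. -/
lemma measurePreserving_pair_pi {n M : ℕ} (ν : Fin n → Measure ℝ)
    [∀ k, IsProbabilityMeasure (ν k)] {i l : Fin M} (hil : i ≠ l) :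
    MeasurePreserving (fun (x : Fin M → Fin n → ℝ) k ↦ (x i k, x l k))
      (Measure.pi fun _ : Fin M ↦ Measure.pi ν) (Measure.pi fun k ↦ (ν k).prod (ν k)) := by
  set P := Measure.pi fun _ : Fin M ↦ Measure.pi ν
  have hind : IndepFun (fun x : Fin M → Fin n → ℝ ↦ x i) (fun x ↦ x l) P :=
    (iIndepFun_pi (μ := fun _ : Fin M ↦ Measure.pi ν) (X := fun _ y ↦ y)
      fun _ ↦ aemeasurable_id).indepFun hil
  have hmap : ∀ j, Measure.map (fun x : Fin M → Fin n → ℝ ↦ x j) P = Measure.pi ν :=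
    fun j ↦ (measurePreserving_eval (fun _ : Fin M ↦ Measure.pi ν) j).map_eq
  have hpair : MeasurePreserving (fun x : Fin M → Fin n → ℝ ↦ (x i, x l)) P
      ((Measure.pi ν).prod (Measure.pi ν)) := by
    refine ⟨by fun_prop, ?_⟩
    rw [(indepFun_iff_map_prod_eq_prod_map_map (measurable_pi_apply i).aemeasurable
      (measurable_pi_apply l).aemeasurable).1 hind, hmap, hmap]
  exact ((measurePreserving_arrowProdEquivProdArrow ℝ ℝ (Fin n) ν ν).symm _).comp hpair

/-- The mean square distance of two independent copies is twice the variance. -/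
lemma integral_sub_sq_prod_self {ν : Measure ℝ} [IsProbabilityMeasure ν]
    (h1 : Integrable (fun t ↦ t) ν) (h2 : Integrable (fun t ↦ (t - ∫ s, s ∂ν) ^ 2) ν) :
    ∫ p : ℝ × ℝ, (p.1 - p.2) ^ 2 ∂ν.prod ν = 2 * ∫ t, (t - ∫ s, s ∂ν) ^ 2 ∂ν := by
  set m := ∫ s, s ∂ν
  have hc : Integrable (fun t ↦ t - m) ν := h1.sub (integrable_const m)
  have hzero : ∫ t, (t - m) ∂ν = 0 := by
    rw [integral_sub h1 (integrable_const m)]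
    simp [m]
  have hexp : ∀ p : ℝ × ℝ, (p.1 - p.2) ^ 2
      = (p.1 - m) ^ 2 + (p.2 - m) ^ 2 - 2 * ((p.1 - m) * (p.2 - m)) := fun p ↦ by ring
  simp_rw [hexp]
  have hadd : Integrable (fun p : ℝ × ℝ ↦ (p.1 - m) ^ 2 + (p.2 - m) ^ 2) (ν.prod ν) :=
    (h2.comp_fst ν).add (h2.comp_snd ν)
  rw [integral_sub hadd ((hc.mul_prod hc).const_mul 2),
    integral_add (h2.comp_fst ν) (h2.comp_snd ν), integral_const_mul,
    integral_prod_mul (fun t ↦ t - m) (fun t ↦ t - m), hzero,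
    integral_fun_fst (fun t ↦ (t - m) ^ 2), integral_fun_snd (fun t ↦ (t - m) ^ 2)]
  simp
  ring

/-- If two vectors have squared norms `A`, `B` close to `R` and inner product `C` with large
normalised value, then their squared distance is at most `3 δ R`. -/
lemma sq_dist_le_of_sqrt_le_inner {A B C R δ : ℝ} (hR : 0 < R) (hδ0 : 0 < δ) (hδ1 : δ < 2 / 3)
    (hA : A ≤ (1 + δ) * R) (hB0 : (1 - δ) * R ≤ B) (hB1 : B ≤ (1 + δ) * R)
    (hC : √(1 - δ) ≤ C / (√R * √B)) : A + B - 2 * C ≤ 3 * δ * R := by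
  have hB : 0 < B := lt_of_lt_of_le (mul_pos (by linarith) hR) hB0
  have hr : 0 < √R := Real.sqrt_pos.2 hR
  have hb : 0 < √B := Real.sqrt_pos.2 hB
  rw [le_div_iff₀ (mul_pos hr hb)] at hC
  have hs2 : √(1 - δ) ^ 2 = 1 - δ := Real.sq_sqrt (by linarith)
  have ht2 : √(1 + δ) ^ 2 = 1 + δ := Real.sq_sqrt (by linarith)
  have hr2 : √R ^ 2 = R := Real.sq_sqrt hR.le
  have hb2 : √B ^ 2 = B := Real.sq_sqrt hB.le
  have hlow : √(1 - δ) * √R ≤ √B := by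
    rw [← Real.sqrt_mul (by linarith)]
    exact Real.sqrt_le_sqrt hB0
  have hup : √B ≤ √(1 + δ) * √R := by
    rw [← Real.sqrt_mul (by linarith)]
    exact Real.sqrt_le_sqrt hB1
  have hts : 1 - δ / 2 ≤ √(1 + δ) * √(1 - δ) := by
    rw [← Real.sqrt_mul (by linarith)]
    exact Real.le_sqrt_of_sq_le (by nlinarith)
  have hsq : (√B - √(1 - δ) * √R) ^ 2 ≤ ((√(1 + δ) - √(1 - δ)) * √R) ^ 2 :=
    pow_le_pow_left₀ (by linarith) (by linarith) 2
  have hgap : ((√(1 + δ) - √(1 - δ)) * √R) ^ 2 ≤ δ * R := by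
    rw [mul_pow, hr2]
    exact mul_le_mul_of_nonneg_right (by nlinarith) hR.le
  have hexp : (√B - √(1 - δ) * √R) ^ 2 = B - 2 * (√(1 - δ) * (√R * √B)) + (1 - δ) * R := by
    linear_combination hb2 + √R ^ 2 * hs2 + (1 - δ) * hr2
  linarith

/-- A union bound over finitely many exceptional sets, for a set that need not be measurable. -/
lemma ofReal_one_sub_le_of_compl_subset {Ω : Type*} [MeasurableSpace Ω] (P : Measure Ω)
    [IsProbabilityMeasure P] {S T : Set Ω} (hST : Sᶜ ⊆ T) {c : ℝ} (hT : P.real T ≤ c) :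
    ENNReal.ofReal (1 - c) ≤ P S := by
  rw [ENNReal.ofReal_le_iff_le_toReal (measure_ne_top _ _)]
  have huniv : P.real Set.univ ≤ P.real S + P.real T :=
    (measureReal_mono (fun ω _ ↦ by
      by_cases h : ω ∈ S
      exacts [Or.inl h, Or.inr (hST h)])).trans (measureReal_union_le S T)
  rw [probReal_univ] at huniv
  change _ ≤ P.real S
  linarith

/-- (Theorem 2, inequality (10).) Let `μ = ν₁ ⊗ … ⊗ νₙ` be a product
probability measure on the unit cube `[0,1]ⁿ` with coordinate means `mₖ`, variances `σₖ²`,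
`R₀² = Σₖ σₖ² > 0`, and let `x₁, …, x_M` be i.i.d. with law `μ`. Then for `0 < δ < 2/3`:
`P(1-δ ≤ ‖xⱼ-x̄‖²/R₀² ≤ 1+δ for all j, and ((xᵢ-x̄)/R₀, (x_M-x̄)/‖x_M-x̄‖) < √(1-δ) for all
i ≠ M) ≥ 1 - 2M·exp(-2δ²R₀⁴/n) - (M-1)·exp(-2R₀⁴(2-3δ)²/n)`. -/
theorem cube_separation_one_point
    (n M : ℕ) (hn : 1 ≤ n) (hM : 1 ≤ M)
    (ν : Fin n → Measure ℝ) [∀ k, IsProbabilityMeasure (ν k)]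
    (hsupp : ∀ k, ν k (Set.Icc (0 : ℝ) 1)ᶜ = 0)
    (m : Fin n → ℝ) (hm : ∀ k, m k = ∫ t, t ∂(ν k))
    (σ2 : Fin n → ℝ) (hσ2 : ∀ k, σ2 k = ∫ t, (t - m k) ^ 2 ∂(ν k))
    (R0sq : ℝ) (hR0 : R0sq = ∑ k, σ2 k) (hR0pos : 0 < R0sq)
    (δ : ℝ) (hδ0 : 0 < δ) (hδ1 : δ < 2 / 3)
    (lst : Fin M) (hlst : (lst : ℕ) = M - 1) :
    (Measure.pi fun _ : Fin M => Measure.pi ν)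
      {x : Fin M → (Fin n → ℝ) |
        (∀ j, 1 - δ ≤ (∑ k, (x j k - m k) ^ 2) / R0sq ∧
              (∑ k, (x j k - m k) ^ 2) / R0sq ≤ 1 + δ) ∧
        ∀ i, i ≠ lst →
          (∑ k, ((x i k - m k) / Real.sqrt R0sq) *
              ((x lst k - m k) / Real.sqrt (∑ k', (x lst k' - m k') ^ 2)))
            < Real.sqrt (1 - δ)}
      ≥ ENNReal.ofReal (1 - 2 * (M : ℝ) * Real.exp (-2 * δ ^ 2 * R0sq ^ 2 / n)
          - ((M : ℝ) - 1) * Real.exp (-2 * R0sq ^ 2 * (2 - 3 * δ) ^ 2 / n)) := by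
  set P := Measure.pi fun _ : Fin M => Measure.pi ν
  have hae : ∀ k, ∀ᵐ t ∂ν k, t ∈ Set.Icc (0 : ℝ) 1 := fun k ↦ mem_ae_iff.2 (hsupp k)
  have hid : ∀ k, Integrable (fun t ↦ t) (ν k) := fun k ↦
    .of_mem_Icc 0 1 aemeasurable_id (hae k)
  have hm01 : ∀ k, m k ∈ Set.Icc (0 : ℝ) 1 := fun k ↦ by
    rw [hm]
    refine ⟨integral_nonneg_of_ae ((hae k).mono fun t ht ↦ ht.1), ?_⟩
    simpa using integral_mono_ae (hid k) (integrable_const (1 : ℝ)) ((hae k).mono fun t ht ↦ ht.2)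
  have hsq_sub : ∀ {a b : ℝ}, a ∈ Set.Icc (0 : ℝ) 1 → b ∈ Set.Icc (0 : ℝ) 1 →
      (a - b) ^ 2 ∈ Set.Icc (0 : ℝ) 1 := fun {a b} ha hb ↦
    ⟨sq_nonneg _, by
      rw [sq_le_one_iff_abs_le_one, abs_le]
      constructor <;> linarith [ha.1, ha.2, hb.1, hb.2]⟩
  have hdev : ∀ k, Measurable fun t : ℝ ↦ (t - m k) ^ 2 := fun k ↦ by fun_prop
  have hdev01 : ∀ k, ∀ᵐ t ∂ν k, (t - m k) ^ 2 ∈ Set.Icc (0 : ℝ) 1 := fun k ↦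
    (hae k).mono fun t ht ↦ hsq_sub ht (hm01 k)
  have hmean : ∑ k, ∫ t, (t - m k) ^ 2 ∂ν k = R0sq := by simp_rw [hR0, hσ2]
  have hε : 0 ≤ δ * R0sq := by positivity
  have hexp1 : -2 * (δ * R0sq) ^ 2 / (n : ℝ) = -2 * δ ^ 2 * R0sq ^ 2 / n := by ring
  have hupper := measureReal_pi_sum_ge_le ν hdev hdev01 hε
  have hlower := measureReal_pi_sum_le_le ν hdev hdev01 hε
  rw [hmean, hexp1] at hupper hlower
  have hpull : ∀ (j : Fin M) (s : Set (Fin n → ℝ)),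
      P.real {x | x j ∈ s} ≤ (Measure.pi ν).real s := fun j s ↦ by
    have hmp := measurePreserving_eval (fun _ : Fin M ↦ Measure.pi ν) j
    refine ENNReal.toReal_mono (measure_ne_top _ _) ?_
    conv_rhs => rw [← hmp.map_eq]
    exact Measure.le_map_apply hmp.measurable.aemeasurable s
  have hpair01 : ∀ k, ∀ᵐ p ∂(ν k).prod (ν k), (p.1 - p.2) ^ 2 ∈ Set.Icc (0 : ℝ) 1 := fun k ↦ by
    filter_upwards [Measure.quasiMeasurePreserving_fst.ae (hae k),
      Measure.quasiMeasurePreserving_snd.ae (hae k)] with p h1 h2 using hsq_sub h1 h2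
  have hpairmean : ∑ k, ∫ p : ℝ × ℝ, (p.1 - p.2) ^ 2 ∂(ν k).prod (ν k) = 2 * R0sq := by
    rw [← hmean, Finset.mul_sum]
    refine Finset.sum_congr rfl fun k _ ↦ ?_
    have hint := Integrable.of_mem_Icc 0 1 (hdev k).aemeasurable (hdev01 k)
    rw [hm] at hint ⊢
    exact integral_sub_sq_prod_self (hid k) hint
  have hdist := measureReal_pi_sum_le_le (fun k ↦ (ν k).prod (ν k))
    (f := fun _ p ↦ (p.1 - p.2) ^ 2) (fun k ↦ by fun_prop) hpair01
    (ε := (2 - 3 * δ) * R0sq) (mul_nonneg (by linarith) hR0pos.le)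
  rw [hpairmean, show -2 * ((2 - 3 * δ) * R0sq) ^ 2 / (n : ℝ)
    = -2 * R0sq ^ 2 * (2 - 3 * δ) ^ 2 / n by ring] at hdist
  have hpullpair : ∀ i, i ≠ lst → P.real {x | ∑ k, (x i k - x lst k) ^ 2
      ≤ 2 * R0sq - (2 - 3 * δ) * R0sq} ≤ Real.exp (-2 * R0sq ^ 2 * (2 - 3 * δ) ^ 2 / n) :=
    fun i hi ↦ by
      have hmp := measurePreserving_pair_pi ν hi
      refine le_trans (ENNReal.toReal_mono (measure_ne_top _ _) ?_) hdist
      conv_rhs => rw [← hmp.map_eq]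
      exact Measure.le_map_apply hmp.measurable.aemeasurable _
  set U : Fin M → Set (Fin M → Fin n → ℝ) := fun j ↦
    {x | x j ∈ {y : Fin n → ℝ | R0sq + δ * R0sq ≤ ∑ k, (y k - m k) ^ 2}} with hU
  set L : Fin M → Set (Fin M → Fin n → ℝ) := fun j ↦
    {x | x j ∈ {y : Fin n → ℝ | ∑ k, (y k - m k) ^ 2 ≤ R0sq - δ * R0sq}} with hL
  set D : Fin M → Set (Fin M → Fin n → ℝ) := fun i ↦
    {x | ∑ k, (x i k - x lst k) ^ 2 ≤ 2 * R0sq - (2 - 3 * δ) * R0sq} with hD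
  have hbound : P.real ((⋃ j ∈ Finset.univ, (L j ∪ U j)) ∪ ⋃ i ∈ Finset.univ.erase lst, D i)
      ≤ 2 * (M : ℝ) * Real.exp (-2 * δ ^ 2 * R0sq ^ 2 / n)
        + ((M : ℝ) - 1) * Real.exp (-2 * R0sq ^ 2 * (2 - 3 * δ) ^ 2 / n) := by
    refine (measureReal_union_le _ _).trans (add_le_add ?_ ?_)
    · refine (measureReal_biUnion_finset_le _ _).trans ?_
      refine (Finset.sum_le_card_nsmul _ _ (2 * Real.exp (-2 * δ ^ 2 * R0sq ^ 2 / n))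
        fun j _ ↦ (measureReal_union_le _ _).trans ?_).trans_eq ?_
      · linarith [(hpull j _).trans hlower, (hpull j _).trans hupper]
      · simp
        ring
    · refine (measureReal_biUnion_finset_le _ _).trans ?_
      refine (Finset.sum_le_card_nsmul _ _ _
        fun i hi ↦ hpullpair i (Finset.ne_of_mem_erase hi)).trans_eq ?_
      simp [Finset.card_erase_of_mem, Nat.cast_sub hM]
  rw [ge_iff_le, sub_sub]
  refine ofReal_one_sub_le_of_compl_subset P ?_ hbound
  rw [Set.compl_subset_comm]
  intro x hx
  simp only [Set.mem_compl_iff, Set.mem_union, Set.mem_iUnion, Finset.mem_univ, Finset.mem_erase,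
    exists_prop, true_and, and_true, not_or, not_exists, not_and, hU, hL, hD, Set.mem_ofPred_eq,
    not_le] at hx
  obtain ⟨hLU, hdiff⟩ := hx
  refine ⟨fun j ↦ ⟨?_, ?_⟩, fun i hi ↦ ?_⟩
  · rw [le_div_iff₀ hR0pos]
    linarith [(hLU j).1]
  · rw [div_le_iff₀ hR0pos]
    linarith [(hLU j).2]
  · by_contra! hcon
    have hsum : ∑ k, ((x i k - m k) / √R0sq) *
        ((x lst k - m k) / √(∑ k', (x lst k' - m k') ^ 2))
        = (∑ k, (x i k - m k) * (x lst k - m k)) /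
          (√R0sq * √(∑ k', (x lst k' - m k') ^ 2)) := by
      simp_rw [div_mul_div_comm, Finset.sum_div]
    rw [hsum] at hcon
    have hle := sq_dist_le_of_sqrt_le_inner (A := ∑ k, (x i k - m k) ^ 2) hR0pos hδ0 hδ1
      (by linarith [(hLU i).2]) (by linarith [(hLU lst).1]) (by linarith [(hLU lst).2]) hcon
    have hexpand : ∑ k, (x i k - x lst k) ^ 2 = ∑ k, (x i k - m k) ^ 2
        + ∑ k, (x lst k - m k) ^ 2 - 2 * ∑ k, (x i k - m k) * (x lst k - m k) := by
      rw [Finset.mul_sum, ← Finset.sum_add_distrib, ← Finset.sum_sub_distrib]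
      exact Finset.sum_congr rfl fun k _ ↦ by ring
    linarith [hdiff i hi]
end

section
/- Let μ be a product probability measure on the unit cube [0,1]^n whose coordinate marginals have means m_k and variances σ_k², let x̄ = (m_1,…,m_n), R_0² = Σ_k σ_k² > 0, and let x_1, …, x_M be i.i.d. random points with law μ. Then for every 0 < δ < 2/3: P( 1 − δ ≤ ‖x_j − x̄‖²/R_0² ≤ 1 + δ for all j, and ((x_i − x̄)/R_0, (x_j − x̄)/‖x_j − x̄‖) < √(1−δ) for all i ≠ j ) ≥ 1 − 2M·exp(−2δ²R_0⁴/n) − M(M−1)·exp(−2R_0⁴(2−3δ)²/n). -/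
open MeasureTheory ProbabilityTheory

/-- **Hoeffding's inequality** on a product space, upper tail, for functions of the separate
coordinates with values in `[0,1]`. -/
lemma pi_real_sum_ge_le {n : ℕ} {Ω : Type*} [MeasurableSpace Ω] (ρ : Fin n → Measure Ω)
    [∀ k, IsProbabilityMeasure (ρ k)] (f : Fin n → Ω → ℝ) (hf : ∀ k, Measurable (f k))
    (hb : ∀ k, ∀ᵐ ω ∂ρ k, f k ω ∈ Set.Icc (0 : ℝ) 1) {t : ℝ} (ht : 0 ≤ t) :
    (Measure.pi ρ).real {ω | ∑ k, ∫ a, f k a ∂ρ k + t ≤ ∑ k, f k (ω k)}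
      ≤ Real.exp (-2 * t ^ 2 / n) := by
  have hind : iIndepFun (fun k (ω : Fin n → Ω) ↦ f k (ω k) - ∫ a, f k a ∂ρ k) (Measure.pi ρ) :=
    iIndepFun_pi (X := fun k a ↦ f k a - ∫ b, f k b ∂ρ k)
      fun k ↦ ((hf k).sub_const _).aemeasurable
  have hsub : ∀ k ∈ (Finset.univ : Finset (Fin n)),
      HasSubgaussianMGF (fun ω : Fin n → Ω ↦ f k (ω k) - ∫ a, f k a ∂ρ k)
        ((‖(1 : ℝ) - 0‖₊ / 2) ^ 2) (Measure.pi ρ) := by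
    intro k _
    have h := hasSubgaussianMGF_of_mem_Icc (hf k).aemeasurable (hb k)
    have hmap := (measurePreserving_eval ρ k).map_eq
    rw [← hmap] at h
    have h2 := HasSubgaussianMGF.of_map (μ := Measure.pi ρ) (Y := Function.eval k)
      (X := fun a ↦ f k a - ∫ b, f k b ∂(Measure.pi ρ).map (Function.eval k))
      (measurable_pi_apply k).aemeasurable h
    rw [hmap] at h2
    exact h2
  have key := HasSubgaussianMGF.measure_sum_ge_le_of_iIndepFun hind hsub ht
  convert key using 2
  · ext ω
    simp only [Set.mem_ofPred_eq, Finset.sum_sub_distrib]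
    exact le_sub_iff_add_le'.symm
  · simp only [sub_zero, nnnorm_one, Finset.sum_const, Finset.card_univ, Fintype.card_fin,
      nsmul_eq_mul]
    rcases eq_or_ne n 0 with rfl | hn
    · simp
    · have : (n : ℝ) ≠ 0 := by exact_mod_cast hn
      push_cast
      field_simp

/-- **Hoeffding's inequality** on a product space, lower tail, for functions of the separate
coordinates with values in `[0,1]`. -/
lemma pi_real_sum_le_le {n : ℕ} {Ω : Type*} [MeasurableSpace Ω] (ρ : Fin n → Measure Ω)
    [∀ k, IsProbabilityMeasure (ρ k)] (f : Fin n → Ω → ℝ) (hf : ∀ k, Measurable (f k))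
    (hb : ∀ k, ∀ᵐ ω ∂ρ k, f k ω ∈ Set.Icc (0 : ℝ) 1) {t : ℝ} (ht : 0 ≤ t) :
    (Measure.pi ρ).real {ω | ∑ k, f k (ω k) ≤ ∑ k, ∫ a, f k a ∂ρ k - t}
      ≤ Real.exp (-2 * t ^ 2 / n) := by
  have key := pi_real_sum_ge_le ρ (fun k a ↦ 1 - f k a) (fun k ↦ (hf k).const_sub _)
    (fun k ↦ by
      filter_upwards [hb k] with a ha
      exact ⟨by linarith [ha.2], by linarith [ha.1]⟩) ht
  have hint : ∀ k, ∫ a, (1 - f k a) ∂ρ k = 1 - ∫ a, f k a ∂ρ k := fun k ↦ by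
    rw [integral_sub (integrable_const _) (Integrable.of_mem_Icc 0 1 (hf k).aemeasurable (hb k))]
    simp
  convert key using 2
  ext ω
  simp only [hint, Set.mem_ofPred_eq, Finset.sum_sub_distrib]
  constructor <;> intro h <;> linarith

/-- The pairs of corresponding coordinates of two distinct points of an i.i.d. sample from a
product measure are distributed according to the product of the squares of the marginals. -/
lemma measurePreserving_pair_coordinates {n M : ℕ} {Ω : Type*} [MeasurableSpace Ω]
    (ν : Fin n → Measure Ω) [∀ k, IsProbabilityMeasure (ν k)] {i j : Fin M} (hij : i ≠ j) :
    MeasurePreserving (fun (x : Fin M → Fin n → Ω) k ↦ (x i k, x j k))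
      (Measure.pi fun _ : Fin M ↦ Measure.pi ν) (Measure.pi fun k ↦ (ν k).prod (ν k)) := by
  have hind : IndepFun (fun x : Fin M → Fin n → Ω ↦ x i) (fun x ↦ x j)
      (Measure.pi fun _ : Fin M ↦ Measure.pi ν) :=
    (iIndepFun_pi (μ := fun _ : Fin M ↦ Measure.pi ν) (X := fun _ a ↦ a)
      fun _ ↦ aemeasurable_id).indepFun hij
  have hpair : MeasurePreserving (fun x : Fin M → Fin n → Ω ↦ (x i, x j))
      (Measure.pi fun _ : Fin M ↦ Measure.pi ν) ((Measure.pi ν).prod (Measure.pi ν)) := by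
    refine ⟨by fun_prop, ?_⟩
    rw [hind.map_prod_eq_prod_map_map (measurable_pi_apply i).aemeasurable
        (measurable_pi_apply j).aemeasurable,
      show (Measure.pi fun _ : Fin M ↦ Measure.pi ν).map (fun x ↦ x i) = _ from
        (measurePreserving_eval (fun _ : Fin M ↦ Measure.pi ν) i).map_eq,
      show (Measure.pi fun _ : Fin M ↦ Measure.pi ν).map (fun x ↦ x j) = _ from
        (measurePreserving_eval (fun _ : Fin M ↦ Measure.pi ν) j).map_eq]
  exact (measurePreserving_arrowProdEquivProdArrow Ω Ω (Fin n) ν ν).symm.comp hpair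

/-- The mean squared difference of two independent copies is twice the variance. -/
lemma integral_prod_sub_sq {ν : Measure ℝ} [IsProbabilityMeasure ν]
    (hν : ∀ᵐ t ∂ν, t ∈ Set.Icc (0 : ℝ) 1) :
    ∫ z, (z.1 - z.2) ^ 2 ∂ν.prod ν = 2 * ∫ t, (t - ∫ s, s ∂ν) ^ 2 ∂ν := by
  set m := ∫ s, s ∂ν
  have hid : Integrable (fun t ↦ t) ν := Integrable.of_mem_Icc 0 1 aemeasurable_id hν
  have hc : Integrable (fun t ↦ t - m) ν := hid.sub (integrable_const _)
  have hsq : Integrable (fun t ↦ (t - m) ^ 2) ν := by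
    refine Integrable.of_bound (by fun_prop) ((1 + |m|) ^ 2) ?_
    filter_upwards [hν] with t ht
    rw [Real.norm_eq_abs, abs_pow]
    gcongr
    exact (abs_sub _ _).trans (by gcongr; exact abs_le.2 ⟨by linarith [ht.1], ht.2⟩)
  have hzero : ∫ t, (t - m) ∂ν = 0 := by
    rw [integral_sub hid (integrable_const _)]
    simp [m]
  have hexp : ∀ z : ℝ × ℝ, (z.1 - z.2) ^ 2
      = (z.1 - m) ^ 2 + (z.2 - m) ^ 2 - 2 * ((z.1 - m) * (z.2 - m)) := fun z ↦ by ring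
  simp_rw [hexp]
  rw [integral_sub (f := fun z : ℝ × ℝ ↦ (z.1 - m) ^ 2 + (z.2 - m) ^ 2)
      ((hsq.comp_fst ν).add (hsq.comp_snd ν)) ((hc.mul_prod hc).const_mul 2),
    integral_add (hsq.comp_fst ν) (hsq.comp_snd ν), integral_const_mul,
    integral_prod_mul (fun t ↦ t - m) (fun t ↦ t - m), hzero,
    integral_fun_fst (fun t ↦ (t - m) ^ 2), integral_fun_snd (fun t ↦ (t - m) ^ 2)]
  simp
  ring

/-- If `a` and `b` have squared norms within a factor `1 ± δ` of `R` and the scaled inner product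
of `a` and `b` is at least `√(1 - δ)`, then `a` and `b` are at squared distance at most `3δR`. -/
lemma sum_sub_sq_le_of_sqrt_le {n : ℕ} (a b : Fin n → ℝ) {R δ : ℝ} (hR : 0 < R) (hδ0 : 0 < δ)
    (hδ1 : δ < 2 / 3) (ha : ∑ k, a k ^ 2 ≤ (1 + δ) * R) (hb1 : (1 - δ) * R ≤ ∑ k, b k ^ 2)
    (hb2 : ∑ k, b k ^ 2 ≤ (1 + δ) * R)
    (hab : √(1 - δ) ≤ ∑ k, (a k / √R) * (b k / √(∑ k', b k' ^ 2))) :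
    ∑ k, (a k - b k) ^ 2 ≤ 3 * δ * R := by
  set B := ∑ k, b k ^ 2
  have hBpos : 0 < B := lt_of_lt_of_le (mul_pos (by linarith) hR) hb1
  have hs : 0 < √B := Real.sqrt_pos.2 hBpos
  have hr : 0 < √R := Real.sqrt_pos.2 hR
  have hinner : √(1 - δ) * √R * √B ≤ ∑ k, a k * b k := by
    have h : ∑ k, (a k / √R) * (b k / √B) = (∑ k, a k * b k) / (√R * √B) := by
      rw [Finset.sum_div]
      exact Finset.sum_congr rfl fun k _ ↦ by rw [div_mul_div_comm]
    rw [h, le_div_iff₀ (by positivity)] at hab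
    linarith
  have hexp : ∑ k, (a k - b k) ^ 2 = ∑ k, a k ^ 2 + B - 2 * ∑ k, a k * b k := by
    rw [Finset.mul_sum, ← Finset.sum_add_distrib, ← Finset.sum_sub_distrib]
    exact Finset.sum_congr rfl fun k _ ↦ by ring
  have hbound : B + (1 - 2 * δ) * R ≤ 2 * (√(1 - δ) * √R * √B) := by
    have hnn : 0 ≤ B + (1 - 2 * δ) * R := by nlinarith
    have hδ : 0 ≤ 1 - δ := by linarith
    rw [← pow_le_pow_iff_left₀ hnn (by positivity) two_ne_zero]
    have : (2 * (√(1 - δ) * √R * √B)) ^ 2 = 4 * ((1 - δ) * R * B) := by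
      rw [mul_pow, mul_pow, mul_pow, Real.sq_sqrt hδ, Real.sq_sqrt hR.le, Real.sq_sqrt hBpos.le]
      ring
    rw [this]
    nlinarith [mul_nonneg (sub_nonneg.2 hb1) (sub_nonneg.2 hb2), mul_nonneg (mul_pos (mul_pos hR hR) hδ0).le (by linarith : 0 ≤ 4 - 5 * δ)]
  linarith

/-- (Theorem 2, inequality (11).) Let `μ = ν₁ ⊗ … ⊗ νₙ` be a product
probability measure on the unit cube `[0,1]ⁿ` with coordinate means `mₖ`, variances `σₖ²`,
`R₀² = Σₖ σₖ² > 0`, and let `x₁, …, x_M` be i.i.d. with law `μ`. Then for `0 < δ < 2/3`: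
`P(1-δ ≤ ‖xⱼ-x̄‖²/R₀² ≤ 1+δ for all j, and ((xᵢ-x̄)/R₀, (xⱼ-x̄)/‖xⱼ-x̄‖) < √(1-δ) for all
i ≠ j) ≥ 1 - 2M·exp(-2δ²R₀⁴/n) - M(M-1)·exp(-2R₀⁴(2-3δ)²/n)`. -/
theorem cube_separation_all_points
    (n M : ℕ) (hn : 1 ≤ n) (hM : 1 ≤ M)
    (ν : Fin n → Measure ℝ) [∀ k, IsProbabilityMeasure (ν k)]
    (hsupp : ∀ k, ν k (Set.Icc (0 : ℝ) 1)ᶜ = 0)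
    (m : Fin n → ℝ) (hm : ∀ k, m k = ∫ t, t ∂(ν k))
    (σ2 : Fin n → ℝ) (hσ2 : ∀ k, σ2 k = ∫ t, (t - m k) ^ 2 ∂(ν k))
    (R0sq : ℝ) (hR0 : R0sq = ∑ k, σ2 k) (hR0pos : 0 < R0sq)
    (δ : ℝ) (hδ0 : 0 < δ) (hδ1 : δ < 2 / 3) :
    (Measure.pi fun _ : Fin M => Measure.pi ν)
      {x : Fin M → (Fin n → ℝ) |
        (∀ j, 1 - δ ≤ (∑ k, (x j k - m k) ^ 2) / R0sq ∧
              (∑ k, (x j k - m k) ^ 2) / R0sq ≤ 1 + δ) ∧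
        ∀ i j, i ≠ j →
          (∑ k, ((x i k - m k) / Real.sqrt R0sq) *
              ((x j k - m k) / Real.sqrt (∑ k', (x j k' - m k') ^ 2)))
            < Real.sqrt (1 - δ)}
      ≥ ENNReal.ofReal (1 - 2 * (M : ℝ) * Real.exp (-2 * δ ^ 2 * R0sq ^ 2 / n)
          - (M : ℝ) * ((M : ℝ) - 1) * Real.exp (-2 * R0sq ^ 2 * (2 - 3 * δ) ^ 2 / n)) := by
  set P : Measure (Fin M → Fin n → ℝ) := Measure.pi fun _ : Fin M => Measure.pi ν
  have hmem : ∀ k, ∀ᵐ t ∂ν k, t ∈ Set.Icc (0 : ℝ) 1 := fun k ↦ by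
    rw [ae_iff]; exact hsupp k
  have hm01 : ∀ k, m k ∈ Set.Icc (0 : ℝ) 1 := fun k ↦ by
    have hint : Integrable (fun t : ℝ ↦ t) (ν k) :=
      Integrable.of_mem_Icc 0 1 aemeasurable_id (hmem k)
    rw [hm k]
    constructor
    · exact integral_nonneg_of_ae ((hmem k).mono fun t ht ↦ ht.1)
    · simpa using integral_mono_ae hint (integrable_const (1 : ℝ)) ((hmem k).mono fun t ht ↦ ht.2)
  have hsqmem : ∀ u ∈ Set.Icc (0 : ℝ) 1, ∀ v ∈ Set.Icc (0 : ℝ) 1,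
      (u - v) ^ 2 ∈ Set.Icc (0 : ℝ) 1 := fun u hu v hv ↦
    ⟨sq_nonneg _, by
      rw [sq_le_one_iff_abs_le_one, abs_le]
      exact ⟨by linarith [hu.1, hv.2], by linarith [hu.2, hv.1]⟩⟩
  have hsum : ∑ k, ∫ t, (t - m k) ^ 2 ∂ν k = R0sq := by
    rw [hR0]; exact Finset.sum_congr rfl fun k _ ↦ (hσ2 k).symm
  have ht1 : 0 ≤ δ * R0sq := by positivity
  have ht2 : 0 ≤ (2 - 3 * δ) * R0sq := mul_nonneg (by linarith) hR0pos.le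
  set e₁ := Real.exp (-2 * δ ^ 2 * R0sq ^ 2 / n) with he₁
  set e₂ := Real.exp (-2 * R0sq ^ 2 * (2 - 3 * δ) ^ 2 / n) with he₂
  have hsqae : ∀ k, ∀ᵐ t ∂ν k, (t - m k) ^ 2 ∈ Set.Icc (0 : ℝ) 1 := fun k ↦
    (hmem k).mono fun t ht ↦ hsqmem t ht _ (hm01 k)
  have hfm : ∀ k, Measurable fun t : ℝ ↦ (t - m k) ^ 2 := fun k ↦ by fun_prop
  let U : Fin M → Set (Fin M → Fin n → ℝ) := fun j ↦
    {x | R0sq + δ * R0sq ≤ ∑ k, (x j k - m k) ^ 2}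
  let L : Fin M → Set (Fin M → Fin n → ℝ) := fun j ↦
    {x | ∑ k, (x j k - m k) ^ 2 ≤ R0sq - δ * R0sq}
  let D : Fin M × Fin M → Set (Fin M → Fin n → ℝ) := fun p ↦
    {x | ∑ k, (x p.1 k - x p.2 k) ^ 2 ≤ 2 * R0sq - (2 - 3 * δ) * R0sq}
  have hU : ∀ j, P.real (U j) ≤ e₁ := fun j ↦ by
    have h := pi_real_sum_ge_le ν (fun k t ↦ (t - m k) ^ 2) hfm hsqae ht1
    rw [hsum, ← (measurePreserving_eval (fun _ : Fin M ↦ Measure.pi ν) j).measureReal_preimage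
      (measurableSet_le (by fun_prop) (by fun_prop)).nullMeasurableSet] at h
    refine h.trans_eq ?_
    rw [he₁]; congr 1; ring
  have hL : ∀ j, P.real (L j) ≤ e₁ := fun j ↦ by
    have h := pi_real_sum_le_le ν (fun k t ↦ (t - m k) ^ 2) hfm hsqae ht1
    rw [hsum, ← (measurePreserving_eval (fun _ : Fin M ↦ Measure.pi ν) j).measureReal_preimage
      (measurableSet_le (by fun_prop) (by fun_prop)).nullMeasurableSet] at h
    refine h.trans_eq ?_
    rw [he₁]; congr 1; ring
  have hD : ∀ p ∈ (Finset.univ : Finset (Fin M)).offDiag, P.real (D p) ≤ e₂ := fun p hp ↦ by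
    have hne : p.1 ≠ p.2 := (Finset.mem_offDiag.1 hp).2.2
    have h := pi_real_sum_le_le (fun k ↦ (ν k).prod (ν k)) (fun _ z ↦ (z.1 - z.2) ^ 2)
      (fun k ↦ by fun_prop) (fun k ↦ by
        filter_upwards [Measure.quasiMeasurePreserving_fst.ae (hmem k),
          Measure.quasiMeasurePreserving_snd.ae (hmem k)] with z hz₁ hz₂
        exact hsqmem _ hz₁ _ hz₂) ht2
    have hsum2 : ∑ k, ∫ z, (z.1 - z.2) ^ 2 ∂(ν k).prod (ν k) = 2 * R0sq := by
      rw [hR0, Finset.mul_sum]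
      exact Finset.sum_congr rfl fun k _ ↦ by rw [integral_prod_sub_sq (hmem k), hσ2, hm]
    rw [hsum2, ← (measurePreserving_pair_coordinates ν hne).measureReal_preimage
      (measurableSet_le (by fun_prop) (by fun_prop)).nullMeasurableSet] at h
    refine h.trans_eq ?_
    rw [he₂]; congr 1; ring
  set S := {x : Fin M → (Fin n → ℝ) |
        (∀ j, 1 - δ ≤ (∑ k, (x j k - m k) ^ 2) / R0sq ∧
              (∑ k, (x j k - m k) ^ 2) / R0sq ≤ 1 + δ) ∧
        ∀ i j, i ≠ j →
          (∑ k, ((x i k - m k) / Real.sqrt R0sq) *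
              ((x j k - m k) / Real.sqrt (∑ k', (x j k' - m k') ^ 2)))
            < Real.sqrt (1 - δ)}
  have hcover : Set.univ ⊆ S ∪ ((⋃ j ∈ (Finset.univ : Finset (Fin M)), (U j ∪ L j)) ∪
      ⋃ p ∈ (Finset.univ : Finset (Fin M)).offDiag, D p) := by
    intro x _
    by_contra hx
    simp only [Set.mem_union, Set.mem_iUnion, not_or, not_exists] at hx
    obtain ⟨hxS, hxN, hxD⟩ := hx
    have hlow : ∀ j, (1 - δ) * R0sq ≤ ∑ k, (x j k - m k) ^ 2 := fun j ↦ by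
      have h : ¬∑ k, (x j k - m k) ^ 2 ≤ R0sq - δ * R0sq := (hxN j (Finset.mem_univ j)).2
      linarith
    have hupp : ∀ j, ∑ k, (x j k - m k) ^ 2 ≤ (1 + δ) * R0sq := fun j ↦ by
      have h : ¬R0sq + δ * R0sq ≤ ∑ k, (x j k - m k) ^ 2 := (hxN j (Finset.mem_univ j)).1
      linarith
    refine hxS ⟨fun j ↦ ⟨(le_div_iff₀ hR0pos).2 (hlow j), (div_le_iff₀ hR0pos).2 (hupp j)⟩,
      fun i j hij ↦ ?_⟩
    by_contra hcon
    have h := sum_sub_sq_le_of_sqrt_le (fun k ↦ x i k - m k) (fun k ↦ x j k - m k) hR0pos hδ0 hδ1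
      (hupp i) (hlow j) (hupp j) (not_lt.1 hcon)
    simp only [sub_sub_sub_cancel_right] at h
    refine hxD (i, j) (Finset.mem_offDiag.2 ⟨Finset.mem_univ _, Finset.mem_univ _, hij⟩) ?_
    change ∑ k, (x i k - x j k) ^ 2 ≤ _
    linarith
  have hN : P.real (⋃ j ∈ (Finset.univ : Finset (Fin M)), (U j ∪ L j)) ≤ 2 * M * e₁ := by
    refine (measureReal_biUnion_finset_le _ _).trans ?_
    refine (Finset.sum_le_sum (g := fun _ ↦ 2 * e₁) fun j _ ↦ ?_).trans_eq ?_
    · linarith [measureReal_union_le (μ := P) (U j) (L j), hU j, hL j]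
    · simp only [Finset.sum_const, Finset.card_univ, Fintype.card_fin, nsmul_eq_mul]
      ring
  have hDD : P.real (⋃ p ∈ (Finset.univ : Finset (Fin M)).offDiag, D p) ≤ M * (M - 1) * e₂ := by
    refine (measureReal_biUnion_finset_le _ _).trans ((Finset.sum_le_sum hD).trans_eq ?_)
    rw [Finset.sum_const, Finset.offDiag_card, Finset.card_univ, Fintype.card_fin, nsmul_eq_mul,
      Nat.cast_sub (Nat.le_mul_self M)]
    push_cast
    ring
  have hone : 1 ≤ P.real S + (2 * M * e₁ + M * (M - 1) * e₂) := by
    calc (1 : ℝ) = P.real Set.univ := by simp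
      _ ≤ _ := measureReal_mono hcover
      _ ≤ _ := measureReal_union_le _ _
      _ ≤ _ := by
        gcongr
        exact (measureReal_union_le _ _).trans (add_le_add hN hDD)
  rw [ge_iff_le, ← ofReal_measureReal (μ := P) (s := S)]
  exact ENNReal.ofReal_le_ofReal (by linarith)
end

section
/- Let μ be a product probability measure on the unit cube [0,1]^n whose coordinate marginals have means m_k and variances σ_k² with σ_k² > σ_0² > 0 for all k, let x̄ = (m_1,…,m_n), R_0² = Σ_k σ_k², and let x_1, …, x_M be i.i.d. random points with law μ. Then P( 1/2 ≤ ‖x_j − x̄‖²/R_0² ≤ 3/2 for all j, and ((x_i − x̄)/R_0, (x_M − x̄)/‖x_M − x̄‖) < √2/2 for all i ≠ M ) ≥ 1 − 3M·exp(−0.5·n·σ_0⁴). -/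
open MeasureTheory ProbabilityTheory

section Auxiliary

variable {n : ℕ} {ν : Fin n → Measure ℝ} [∀ k, IsProbabilityMeasure (ν k)]

/-- **Hoeffding's inequality** for sums of functions of the coordinates under a product measure. -/
lemma measure_pi_sum_ge_le {f : Fin n → ℝ → ℝ} {c : Fin n → NNReal}
    (hf : ∀ k, Measurable (f k)) (h : ∀ k, HasSubgaussianMGF (f k) (c k) (ν k))
    {ε : ℝ} (hε : 0 ≤ ε) :
    Measure.pi ν {x | ε ≤ ∑ k, f k (x k)} ≤
      ENNReal.ofReal (Real.exp (-ε ^ 2 / (2 * ∑ k, (c k : ℝ)))) := by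
  rw [ENNReal.le_ofReal_iff_toReal_le (measure_ne_top _ _) (Real.exp_pos _).le]
  have hind : iIndepFun (fun k (x : Fin n → ℝ) => f k (x k)) (Measure.pi ν) :=
    iIndepFun_pi fun k => (hf k).aemeasurable
  have hsub : ∀ k ∈ Finset.univ,
      HasSubgaussianMGF (fun x : Fin n → ℝ => f k (x k)) (c k) (Measure.pi ν) := by
    intro k _
    refine HasSubgaussianMGF.of_map (Y := fun x : Fin n → ℝ => x k) (X := f k)
      (measurable_pi_apply k).aemeasurable ?_
    rw [show (Measure.pi ν).map (fun x : Fin n → ℝ => x k) = ν k from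
      (measurePreserving_eval ν k).map_eq]
    exact h k
  simpa [Measure.real] using HasSubgaussianMGF.measure_sum_ge_le_of_iIndepFun hind hsub hε

lemma integral_mem_Icc_zero_one {μ : Measure ℝ} [IsProbabilityMeasure μ]
    (h : μ (Set.Icc (0 : ℝ) 1)ᶜ = 0) : ∫ t, t ∂μ ∈ Set.Icc (0 : ℝ) 1 := by
  have hae : ∀ᵐ t ∂μ, t ∈ Set.Icc (0 : ℝ) 1 := h
  have hint : Integrable (fun t : ℝ => t) μ := Integrable.of_mem_Icc 0 1 aemeasurable_id hae
  constructor
  · exact integral_nonneg_of_ae (hae.mono fun t ht => ht.1)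
  · simpa using integral_mono_ae hint (integrable_const (1 : ℝ)) (hae.mono fun t ht => ht.2)

/-- Squared deviations from a centre in `[0,1]` are sub-Gaussian with the Hoeffding constant. -/
lemma hasSubgaussianMGF_sq_sub {μ : Measure ℝ} [IsProbabilityMeasure μ]
    (h : μ (Set.Icc (0 : ℝ) 1)ᶜ = 0) {a : ℝ} (ha : a ∈ Set.Icc (0 : ℝ) 1) :
    HasSubgaussianMGF (fun t => (t - a) ^ 2 - ∫ s, (s - a) ^ 2 ∂μ) ((1 / 2) ^ 2) μ := by
  have hae : ∀ᵐ t ∂μ, t ∈ Set.Icc (0 : ℝ) 1 := h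
  have := hasSubgaussianMGF_of_mem_Icc (μ := μ) (X := fun t => (t - a) ^ 2) (a := 0) (b := 1)
    (by fun_prop) (hae.mono fun t ht => by
      obtain ⟨h0, h1⟩ := ht
      obtain ⟨h2, h3⟩ := ha
      exact ⟨sq_nonneg _, by rw [sq_le_one_iff_abs_le_one, abs_le]; constructor <;> linarith⟩)
  simpa using this

lemma hasSubgaussianMGF_sub_integral {μ : Measure ℝ} [IsProbabilityMeasure μ]
    (h : μ (Set.Icc (0 : ℝ) 1)ᶜ = 0) :
    HasSubgaussianMGF (fun t => t - ∫ s, s ∂μ) ((1 / 2) ^ 2) μ := by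
  have hae : ∀ᵐ t ∂μ, t ∈ Set.Icc (0 : ℝ) 1 := h
  simpa using hasSubgaussianMGF_of_mem_Icc (μ := μ) (X := fun t => t) (a := 0) (b := 1)
    (by fun_prop) hae

/-- Concentration of the squared distance to the mean around its expectation. -/
lemma measure_pi_sq_dist_le (hn : 1 ≤ n) (hsupp : ∀ k, ν k (Set.Icc (0 : ℝ) 1)ᶜ = 0)
    {m : Fin n → ℝ} (hm : ∀ k, m k ∈ Set.Icc (0 : ℝ) 1)
    {s : ℝ} (hs : 0 < s) (hR : n * s ≤ ∑ k, ∫ t, (t - m k) ^ 2 ∂(ν k)) :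
    Measure.pi ν {x | ¬ (1 / 2 ≤ (∑ k, (x k - m k) ^ 2) / ∑ k, ∫ t, (t - m k) ^ 2 ∂(ν k) ∧
      (∑ k, (x k - m k) ^ 2) / ∑ k, ∫ t, (t - m k) ^ 2 ∂(ν k) ≤ 3 / 2)} ≤
      2 * ENNReal.ofReal (Real.exp (-0.5 * n * s ^ 2)) := by
  set R := ∑ k, ∫ t, (t - m k) ^ 2 ∂(ν k) with hRdef
  have hn0 : (0 : ℝ) < n := by exact_mod_cast hn
  have hR0 : 0 < R := lt_of_lt_of_le (by positivity) hR
  have hsub := fun k => hasSubgaussianMGF_sq_sub (hsupp k) (hm k)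
  have upper := measure_pi_sum_ge_le (ν := ν) (fun k => by fun_prop) hsub (half_pos hR0).le
  have lower := measure_pi_sum_ge_le (ν := ν) (fun k => by fun_prop) (fun k => (hsub k).neg)
    (half_pos hR0).le
  have hexp : Real.exp (-(R / 2) ^ 2 / (2 * ∑ _k : Fin n, (((1 / 2) ^ 2 : NNReal) : ℝ))) ≤
      Real.exp (-0.5 * n * s ^ 2) := by
    apply Real.exp_le_exp.2
    have hsq : (n * s) ^ 2 ≤ R ^ 2 := pow_le_pow_left₀ (by positivity) hR 2
    simp only [Finset.sum_const, Finset.card_univ, Fintype.card_fin, nsmul_eq_mul]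
    push_cast
    rw [div_le_iff₀ (by positivity)]
    nlinarith
  replace upper := upper.trans (ENNReal.ofReal_le_ofReal hexp)
  replace lower := lower.trans (ENNReal.ofReal_le_ofReal hexp)
  rw [two_mul]
  refine le_trans ?_ (add_le_add lower upper)
  refine le_trans (measure_mono ?_) (measure_union_le _ _)
  intro x hx
  simp only [Set.mem_ofPred_eq, Set.mem_union, Pi.neg_apply, Finset.sum_neg_distrib,
    Finset.sum_sub_distrib, ← hRdef] at hx ⊢
  rw [le_div_iff₀ hR0, div_le_iff₀ hR0, not_and_or, not_le, not_le] at hx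
  rcases hx with hx | hx
  · left; linarith
  · right; linarith

/-- A centred random point of the cube rarely has a large component in a fixed direction. -/
lemma measure_pi_inner_ge_le (hsupp : ∀ k, ν k (Set.Icc (0 : ℝ) 1)ᶜ = 0)
    {m : Fin n → ℝ} (hm : ∀ k, m k = ∫ t, t ∂(ν k)) {R : ℝ} (hR : 0 < R) (v : Fin n → ℝ) :
    Measure.pi ν {x | Real.sqrt 2 / 2 ≤ ∑ k, ((x k - m k) / Real.sqrt R) *
      (v k / Real.sqrt (∑ k', v k' ^ 2))} ≤ ENNReal.ofReal (Real.exp (-R)) := by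
  set V := ∑ k', v k' ^ 2 with hV
  have hV0 : 0 ≤ V := Finset.sum_nonneg fun k _ => sq_nonneg _
  rcases hV0.eq_or_lt with h0 | hpos
  · have : {x : Fin n → ℝ | Real.sqrt 2 / 2 ≤ ∑ k, ((x k - m k) / Real.sqrt R) *
        (v k / Real.sqrt V)} = ∅ := by
      simp [← h0, Set.eq_empty_iff_forall_notMem]
    simp [this]
  have hsub : ∀ k, HasSubgaussianMGF
      (fun t => v k / Real.sqrt V / Real.sqrt R * (t - ∫ s, s ∂(ν k)))
      (NNReal.mk ((v k / Real.sqrt V / Real.sqrt R) ^ 2) (sq_nonneg _) * (1 / 2) ^ 2) (ν k) :=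
    fun k => (hasSubgaussianMGF_sub_integral (hsupp k)).const_mul _
  have key := measure_pi_sum_ge_le (ν := ν) (fun k => by fun_prop) hsub
    (ε := Real.sqrt 2 / 2) (by positivity)
  convert key using 3
  · ext x
    simp only [hm]
    rw [Finset.sum_congr rfl fun k _ => ?_]
    ring
  · have hsum : ∑ k, ((NNReal.mk ((v k / Real.sqrt V / Real.sqrt R) ^ 2) (sq_nonneg _) *
        (1 / 2) ^ 2 : NNReal) : ℝ) = 1 / (4 * R) := by
      have : ∀ k, ((NNReal.mk ((v k / Real.sqrt V / Real.sqrt R) ^ 2) (sq_nonneg _) *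
        (1 / 2) ^ 2 : NNReal) : ℝ) = v k ^ 2 * (1 / (4 * V * R)) := by
        intro k
        push_cast
        rw [div_pow, div_pow, Real.sq_sqrt hV0, Real.sq_sqrt hR.le]
        field_simp
        norm_num
      simp_rw [this]
      rw [← Finset.sum_mul, ← hV]
      field_simp
    rw [hsum, div_pow, Real.sq_sqrt (by norm_num)]
    field_simp
    norm_num

end Auxiliary

/-- For two distinct coordinates of an i.i.d. tuple, a bound on every section of an event bounds
the probability of the event. -/
lemma measure_pi_pair_le {ι Ω : Type*} [Fintype ι] [MeasurableSpace Ω] {μ : Measure Ω}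
    [IsProbabilityMeasure μ] {i j : ι} (hij : i ≠ j) {s : Set (Ω × Ω)} (hs : MeasurableSet s)
    {c : ENNReal} (h : ∀ b, μ {a | (a, b) ∈ s} ≤ c) :
    Measure.pi (fun _ : ι => μ) {x | (x i, x j) ∈ s} ≤ c := by
  have hind : iIndepFun (fun k (x : ι → Ω) => x k) (Measure.pi fun _ : ι => μ) :=
    iIndepFun_pi (X := fun _ => id) fun _ => aemeasurable_id
  have hmap := (indepFun_iff_map_prod_eq_prod_map_map (measurable_pi_apply i).aemeasurable
    (measurable_pi_apply j).aemeasurable).1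
    (hind.indepFun hij)
  have heval : ∀ k, (Measure.pi fun _ : ι => μ).map (fun x : ι → Ω => x k) = μ := fun k =>
    (measurePreserving_eval (fun _ : ι => μ) k).map_eq
  rw [heval, heval] at hmap
  have hmeas : Measurable fun x : ι → Ω => (x i, x j) := by fun_prop
  calc Measure.pi (fun _ : ι => μ) {x | (x i, x j) ∈ s}
      = (μ.prod μ) s := by rw [← hmap, Measure.map_apply hmeas hs]; rfl
    _ = ∫⁻ b, μ {a | (a, b) ∈ s} ∂μ := Measure.prod_apply_symm hs
    _ ≤ ∫⁻ _, c ∂μ := lintegral_mono h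
    _ = c := by simp

/-- (Inequality (12).) Let `μ = ν₁ ⊗ … ⊗ νₙ` be a product probability
measure on `[0,1]ⁿ` with coordinate means `mₖ` and variances `σₖ² > σ₀² > 0`,
`R₀² = Σₖ σₖ²`, and let `x₁, …, x_M` be i.i.d. with law `μ`. Then
`P(1/2 ≤ ‖xⱼ-x̄‖²/R₀² ≤ 3/2 for all j, and ((xᵢ-x̄)/R₀, (x_M-x̄)/‖x_M-x̄‖) < √2/2 for all
i ≠ M) ≥ 1 - 3M·exp(-0.5nσ₀⁴)`. -/
theorem cube_separation_one_point_simplified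
    (n M : ℕ) (hn : 1 ≤ n) (hM : 1 ≤ M)
    (ν : Fin n → Measure ℝ) [∀ k, IsProbabilityMeasure (ν k)]
    (hsupp : ∀ k, ν k (Set.Icc (0 : ℝ) 1)ᶜ = 0)
    (m : Fin n → ℝ) (hm : ∀ k, m k = ∫ t, t ∂(ν k))
    (σ2 : Fin n → ℝ) (hσ2 : ∀ k, σ2 k = ∫ t, (t - m k) ^ 2 ∂(ν k))
    (σ0sq : ℝ) (hσ0pos : 0 < σ0sq) (hvar : ∀ k, σ0sq < σ2 k)
    (R0sq : ℝ) (hR0 : R0sq = ∑ k, σ2 k)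
    (lst : Fin M) (hlst : (lst : ℕ) = M - 1) :
    (Measure.pi fun _ : Fin M => Measure.pi ν)
      {x : Fin M → (Fin n → ℝ) |
        (∀ j, 1 / 2 ≤ (∑ k, (x j k - m k) ^ 2) / R0sq ∧
              (∑ k, (x j k - m k) ^ 2) / R0sq ≤ 3 / 2) ∧
        ∀ i, i ≠ lst →
          (∑ k, ((x i k - m k) / Real.sqrt R0sq) *
              ((x lst k - m k) / Real.sqrt (∑ k', (x lst k' - m k') ^ 2)))
            < Real.sqrt 2 / 2}
      ≥ ENNReal.ofReal (1 - 3 * (M : ℝ) * Real.exp (-0.5 * n * σ0sq ^ 2)) := by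
  have hn0 : (0 : ℝ) < n := by exact_mod_cast hn
  have hm01 : ∀ k, m k ∈ Set.Icc (0 : ℝ) 1 := fun k => hm k ▸ integral_mem_Icc_zero_one (hsupp k)
  have hRsum : R0sq = ∑ k, ∫ t, (t - m k) ^ 2 ∂(ν k) := by rw [hR0]; simp_rw [hσ2]
  have hRn : n * σ0sq ≤ R0sq := by
    rw [hR0]
    simpa using Finset.sum_le_sum fun k (_ : k ∈ Finset.univ) => (hvar k).le
  have hRpos : 0 < R0sq := lt_of_lt_of_le (by positivity) hRn
  have hσ1 : σ0sq ≤ 1 := by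
    have hae : ∀ᵐ t ∂(ν ⟨0, hn⟩), t ∈ Set.Icc (0 : ℝ) 1 := hsupp _
    obtain ⟨h2, h3⟩ := hm01 ⟨0, hn⟩
    have hle : ∀ᵐ t ∂(ν ⟨0, hn⟩), (t - m ⟨0, hn⟩) ^ 2 ∈ Set.Icc (0 : ℝ) 1 :=
      hae.mono fun t ht => by
        obtain ⟨h0, h1⟩ := ht
        exact ⟨sq_nonneg _, by rw [sq_le_one_iff_abs_le_one, abs_le]; constructor <;> linarith⟩
    have hint := Integrable.of_mem_Icc 0 1 (by fun_prop) hle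
    have := integral_mono_ae hint (integrable_const (1 : ℝ)) (hle.mono fun t ht => ht.2)
    rw [← hσ2] at this
    simp only [integral_const, probReal_univ, smul_eq_mul, mul_one] at this
    exact (hvar _).le.trans this
  set E := Real.exp (-0.5 * n * σ0sq ^ 2)
  have hE0 : 0 ≤ E := (Real.exp_pos _).le
  have hexp : Real.exp (-R0sq) ≤ E := by
    apply Real.exp_le_exp.2
    nlinarith [mul_nonneg hn0.le (mul_nonneg hσ0pos.le (sub_nonneg.2 hσ1)),
      mul_pos hn0 hσ0pos]
  set P := Measure.pi fun _ : Fin M => Measure.pi ν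
  let A : Fin M → Set (Fin M → Fin n → ℝ) := fun j =>
    {x | ¬ (1 / 2 ≤ (∑ k, (x j k - m k) ^ 2) / R0sq ∧ (∑ k, (x j k - m k) ^ 2) / R0sq ≤ 3 / 2)}
  let B : Fin M → Set (Fin M → Fin n → ℝ) := fun i =>
    {x | i ≠ lst ∧ Real.sqrt 2 / 2 ≤ ∑ k, ((x i k - m k) / Real.sqrt R0sq) *
      ((x lst k - m k) / Real.sqrt (∑ k', (x lst k' - m k') ^ 2))}
  have hA : ∀ j, P (A j) ≤ 2 * ENNReal.ofReal E := by
    intro j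
    have h1 := measure_pi_sq_dist_le (ν := ν) hn hsupp hm01 hσ0pos (hRsum ▸ hRn)
    rw [← hRsum] at h1
    have hmeas : MeasurableSet {x : Fin n → ℝ | ¬ (1 / 2 ≤ (∑ k, (x k - m k) ^ 2) / R0sq ∧
        (∑ k, (x k - m k) ^ 2) / R0sq ≤ 3 / 2)} :=
      have hf : Measurable fun x : Fin n → ℝ => (∑ k, (x k - m k) ^ 2) / R0sq := by fun_prop
      ((measurableSet_le measurable_const hf).inter (measurableSet_le hf measurable_const)).compl
    exact ((measurePreserving_eval (fun _ : Fin M => Measure.pi ν) j).measure_preimage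
      hmeas.nullMeasurableSet).le.trans h1
  have hB : ∀ i, P (B i) ≤ ENNReal.ofReal E := by
    intro i
    by_cases hi : i = lst
    · simp [B, hi]
    have h2 := measure_pi_pair_le (μ := Measure.pi ν) hi
      (s := {p : (Fin n → ℝ) × (Fin n → ℝ) | Real.sqrt 2 / 2 ≤
        ∑ k, ((p.1 k - m k) / Real.sqrt R0sq) *
          ((p.2 k - m k) / Real.sqrt (∑ k', (p.2 k' - m k') ^ 2))})
      (measurableSet_le measurable_const (by fun_prop))
      (fun b => measure_pi_inner_ge_le hsupp hm hRpos fun k => b k - m k)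
    exact (measure_mono fun x hx => hx.2).trans (h2.trans (ENNReal.ofReal_le_ofReal hexp))
  rw [ge_iff_le, ENNReal.ofReal_sub _ (by positivity), ENNReal.ofReal_one, tsub_le_iff_right]
  refine (measure_univ (μ := P)).ge.trans
    ((measure_univ_le_add_compl _).trans (add_le_add le_rfl ?_))
  calc P _ ≤ P (⋃ j, A j ∪ B j) := by
        refine measure_mono fun x hx => ?_
        by_contra hcon
        simp only [Set.mem_iUnion, Set.mem_union, not_exists, not_or] at hcon
        exact hx ⟨fun j => not_not.1 (hcon j).1,
          fun i hi => not_le.1 fun hle => (hcon i).2 ⟨hi, hle⟩⟩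
    _ ≤ ∑ j, P (A j ∪ B j) := measure_iUnion_fintype_le _ _
    _ ≤ ∑ _j : Fin M, (2 * ENNReal.ofReal E + ENNReal.ofReal E) :=
        Finset.sum_le_sum fun j _ => (measure_union_le _ _).trans (add_le_add (hA j) (hB j))
    _ = ENNReal.ofReal (3 * (M : ℝ) * E) := by
        rw [Finset.sum_const, Finset.card_univ, Fintype.card_fin, nsmul_eq_mul,
          ENNReal.ofReal_mul (by positivity), ENNReal.ofReal_mul (by norm_num),
          ENNReal.ofReal_natCast, ENNReal.ofReal_ofNat]
        ring
end

section
/- Let μ be a product probability measure on the unit cube [0,1]^n whose coordinate marginals have means m_k and variances σ_k² with σ_k² > σ_0² > 0 for all k, let x̄ = (m_1,…,m_n), R_0² = Σ_k σ_k², let x_1, …, x_M be i.i.d. random points with law μ, and let 0 < ϑ < 1. If M < (1/3)·ϑ·exp(0.5·n·σ_0⁴), then with probability greater than 1 − ϑ both 1/2 ≤ ‖x_j − x̄‖²/R_0² ≤ 3/2 for all j, and ((x_i − x̄)/R_0, (x_M − x̄)/‖x_M − x̄‖) < √2/2 for all i ≠ M. -/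
open MeasureTheory ProbabilityTheory

/-- **Hoeffding's inequality** on a product space, for a sum of centred functions of the
coordinates, each taking values in an interval of length one. -/
theorem pi_measure_sum_ge_le {n : ℕ} (ν : Fin n → Measure ℝ) [∀ k, IsProbabilityMeasure (ν k)]
    {f : Fin n → ℝ → ℝ} (hf : ∀ k, Measurable (f k))
    (hrange : ∀ k, ∃ a, ∀ᵐ t ∂(ν k), f k t ∈ Set.Icc a (a + 1))
    (hmean : ∀ k, ∫ t, f k t ∂(ν k) = 0) {s : ℝ} (hs : 0 ≤ s) :
    Measure.pi ν {x | s ≤ ∑ k, f k (x k)} ≤ ENNReal.ofReal (Real.exp (-(2 * s ^ 2 / n))) := by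
  have hsub : ∀ k ∈ Finset.univ,
      HasSubgaussianMGF (fun x : Fin n → ℝ => f k (x k)) (1 / 4) (Measure.pi ν) := by
    intro k _
    obtain ⟨a, ha⟩ := hrange k
    have h := hasSubgaussianMGF_of_mem_Icc_of_integral_eq_zero (hf k).aemeasurable ha (hmean k)
    rw [show ((‖a + 1 - a‖₊ / 2) ^ 2 : NNReal) = 1 / 4 by
      rw [add_sub_cancel_left, nnnorm_one]; norm_num,
      ← (measurePreserving_eval ν k).map_eq] at h
    exact h.of_map (measurable_pi_apply k).aemeasurable
  have hind : iIndepFun (fun k (x : Fin n → ℝ) => f k (x k)) (Measure.pi ν) :=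
    iIndepFun_pi fun k => (hf k).aemeasurable
  have h := HasSubgaussianMGF.measure_sum_ge_le_of_iIndepFun hind hsub hs
  rw [← ofReal_measureReal]
  refine ENNReal.ofReal_le_ofReal (h.trans_eq ?_)
  congr 1
  simp only [Finset.sum_const, Finset.card_univ, Fintype.card_fin, nsmul_eq_mul]
  push_cast
  rcases eq_or_ne (n : ℝ) 0 with h0 | h0
  · simp [h0]
  · field_simp
    ring

/-- If every section of a measurable event in the first variable has measure at most `c`, then the
event that two distinct members of an i.i.d. family satisfy it has measure at most `c`. -/
theorem pi_measure_pair_le {ι α : Type*} [Fintype ι] [MeasurableSpace α] (P : Measure α)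
    [IsProbabilityMeasure P] {i j : ι} (hij : i ≠ j) {A : Set (α × α)} (hA : MeasurableSet A)
    {c : ENNReal} (hc : ∀ᵐ z ∂P, P {y | (z, y) ∈ A} ≤ c) :
    (Measure.pi fun _ : ι => P) {x | (x j, x i) ∈ A} ≤ c := by
  have hind : iIndepFun (fun k (x : ι → α) => x k) (Measure.pi fun _ : ι => P) :=
    iIndepFun_pi (X := fun _ => id) fun _ => aemeasurable_id
  have hmap := (hind.indepFun hij.symm).map_prod_eq_prod_map_map
    (measurable_pi_apply j).aemeasurable (measurable_pi_apply i).aemeasurable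
  have hev : ∀ k : ι, (Measure.pi fun _ : ι => P).map (fun x => x k) = P := fun k =>
    (measurePreserving_eval (fun _ : ι => P) k).map_eq
  rw [hev, hev] at hmap
  change (Measure.pi fun _ : ι => P) ((fun x => (x j, x i)) ⁻¹' A) ≤ c
  rw [← Measure.map_apply (by fun_prop) hA, hmap, Measure.prod_apply hA]
  calc ∫⁻ z, P (Prod.mk z ⁻¹' A) ∂P ≤ ∫⁻ _, c ∂P := lintegral_mono_ae hc
    _ = c := by simp

/-- For `|w| ≤ 1`, the map `t ↦ (t - m) * w` sends the unit interval into an interval of length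
one. -/
theorem exists_mul_sub_mem_Icc {m w : ℝ} (hw : |w| ≤ 1) :
    ∃ a, ∀ t ∈ Set.Icc (0 : ℝ) 1, (t - m) * w ∈ Set.Icc a (a + 1) := by
  obtain ⟨h1, h2⟩ := abs_le.mp hw
  rcases le_total 0 w with h | h
  · exact ⟨-m * w, fun t ht => ⟨by nlinarith [ht.1, ht.2], by nlinarith [ht.1, ht.2]⟩⟩
  · exact ⟨(1 - m) * w, fun t ht => ⟨by nlinarith [ht.1, ht.2], by nlinarith [ht.1, ht.2]⟩⟩

/-- If `‖z‖² ≥ R² / 2` and the normalised inner product of `y` and `z` is at least `√2 / 2`, then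
the inner product itself is at least `R² / 2`. -/
theorem half_le_sum_mul_of_le_normalized {ι : Type*} [Fintype ι] {y z : ι → ℝ} {R : ℝ} (hR : 0 < R)
    (hz : 1 / 2 ≤ (∑ k, z k ^ 2) / R)
    (h : Real.sqrt 2 / 2 ≤ ∑ k, y k / Real.sqrt R * (z k / Real.sqrt (∑ k', z k' ^ 2))) :
    R / 2 ≤ ∑ k, y k * z k := by
  set S := ∑ k, z k ^ 2
  have hS : R / 2 ≤ S := by
    rw [le_div_iff₀ hR] at hz
    linarith
  have hsR := Real.sqrt_pos.mpr hR
  have hsS : 0 < Real.sqrt S := Real.sqrt_pos.mpr (by linarith)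
  have heq : ∑ k, y k / Real.sqrt R * (z k / Real.sqrt S)
      = (∑ k, y k * z k) / (Real.sqrt R * Real.sqrt S) := by
    rw [Finset.sum_div]
    exact Finset.sum_congr rfl fun k _ => div_mul_div_comm _ _ _ _
  rw [heq, le_div_iff₀ (by positivity)] at h
  have h2 : Real.sqrt R ≤ Real.sqrt 2 * Real.sqrt S := by
    rw [← Real.sqrt_mul (by norm_num)]
    exact Real.sqrt_le_sqrt (by linarith)
  have h3 : Real.sqrt R * Real.sqrt R = R := Real.mul_self_sqrt hR.le
  nlinarith [mul_le_mul_of_nonneg_left h2 hsR.le]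

/-- (Corollary 2, first part.) Let `μ = ν₁ ⊗ … ⊗ νₙ` be a product
probability measure on `[0,1]ⁿ` with coordinate means `mₖ` and variances `σₖ² > σ₀² > 0`,
`R₀² = Σₖ σₖ²`, let `x₁, …, x_M` be i.i.d. with law `μ` and `0 < ϑ < 1`. If
`M < (1/3)ϑ·exp(0.5nσ₀⁴)` then with probability `> 1 - ϑ`:
`1/2 ≤ ‖xⱼ-x̄‖²/R₀² ≤ 3/2` for all `j` and `((xᵢ-x̄)/R₀, (x_M-x̄)/‖x_M-x̄‖) < √2/2` for all
`i ≠ M`. -/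
theorem cube_separation_cardinality_one_point
    (n M : ℕ) (hn : 1 ≤ n) (hM : 1 ≤ M)
    (ν : Fin n → Measure ℝ) [∀ k, IsProbabilityMeasure (ν k)]
    (hsupp : ∀ k, ν k (Set.Icc (0 : ℝ) 1)ᶜ = 0)
    (m : Fin n → ℝ) (hm : ∀ k, m k = ∫ t, t ∂(ν k))
    (σ2 : Fin n → ℝ) (hσ2 : ∀ k, σ2 k = ∫ t, (t - m k) ^ 2 ∂(ν k))
    (σ0sq : ℝ) (hσ0pos : 0 < σ0sq) (hvar : ∀ k, σ0sq < σ2 k)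
    (R0sq : ℝ) (hR0 : R0sq = ∑ k, σ2 k)
    (ϑ : ℝ) (hϑ0 : 0 < ϑ) (hϑ1 : ϑ < 1)
    (lst : Fin M) (hlst : (lst : ℕ) = M - 1)
    (hcard : (M : ℝ) < (1 / 3) * ϑ * Real.exp (0.5 * n * σ0sq ^ 2)) :
    (Measure.pi fun _ : Fin M => Measure.pi ν)
      {x : Fin M → (Fin n → ℝ) |
        (∀ j, 1 / 2 ≤ (∑ k, (x j k - m k) ^ 2) / R0sq ∧
              (∑ k, (x j k - m k) ^ 2) / R0sq ≤ 3 / 2) ∧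
        ∀ i, i ≠ lst →
          (∑ k, ((x i k - m k) / Real.sqrt R0sq) *
              ((x lst k - m k) / Real.sqrt (∑ k', (x lst k' - m k') ^ 2)))
            < Real.sqrt 2 / 2}
      > ENNReal.ofReal (1 - ϑ) := by
  have hnpos : (0 : ℝ) < n := by exact_mod_cast hn
  have hsum : n * σ0sq < R0sq := by
    rw [hR0]
    have : ∑ _k : Fin n, σ0sq < ∑ k, σ2 k :=
      Finset.sum_lt_sum_of_nonempty ⟨⟨0, hn⟩, Finset.mem_univ _⟩ fun k _ => hvar k
    simpa using this
  have hRpos : 0 < R0sq := lt_trans (by positivity) hsum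
  have hIcc : ∀ k, ∀ᵐ t ∂(ν k), t ∈ Set.Icc (0 : ℝ) 1 := fun k => mem_ae_iff.mpr (hsupp k)
  have hint : ∀ k, Integrable (fun t => t) (ν k) := fun k =>
    Integrable.of_mem_Icc 0 1 aemeasurable_id (hIcc k)
  have hm01 : ∀ k, m k ∈ Set.Icc (0 : ℝ) 1 := by
    intro k
    rw [hm k]
    constructor
    · exact integral_nonneg_of_ae ((hIcc k).mono fun t ht => ht.1)
    · simpa using integral_mono_ae (hint k) (integrable_const (1 : ℝ))
        ((hIcc k).mono fun t ht => ht.2)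
  have hsq : ∀ k, ∀ᵐ t ∂(ν k), (t - m k) ^ 2 ∈ Set.Icc (0 : ℝ) 1 := fun k =>
    (hIcc k).mono fun t ht =>
      ⟨sq_nonneg _, by nlinarith [ht.1, ht.2, (hm01 k).1, (hm01 k).2]⟩
  have hsqint : ∀ k, Integrable (fun t => (t - m k) ^ 2) (ν k) := fun k =>
    Integrable.of_mem_Icc 0 1 (by fun_prop) (hsq k)
  set e : ℝ := Real.exp (-(2 * (R0sq / 2) ^ 2 / n)) with he
  -- Upper deviation of the squared distance to the mean.
  have hup : Measure.pi ν {y | R0sq / 2 ≤ ∑ k, ((y k - m k) ^ 2 - σ2 k)} ≤ ENNReal.ofReal e := by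
    refine pi_measure_sum_ge_le ν (f := fun k t => (t - m k) ^ 2 - σ2 k)
      (fun k => by fun_prop) (fun k => ⟨-σ2 k, ?_⟩) (fun k => ?_) (by positivity)
    · exact (hsq k).mono fun t ht => ⟨by linarith [ht.1], by linarith [ht.2]⟩
    · rw [integral_sub (hsqint k) (integrable_const _), ← hσ2 k]
      simp
  -- Lower deviation of the squared distance to the mean.
  have hlow : Measure.pi ν {y | R0sq / 2 ≤ ∑ k, (σ2 k - (y k - m k) ^ 2)} ≤ ENNReal.ofReal e := by
    refine pi_measure_sum_ge_le ν (f := fun k t => σ2 k - (t - m k) ^ 2)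
      (fun k => by fun_prop) (fun k => ⟨σ2 k - 1, ?_⟩) (fun k => ?_) (by positivity)
    · exact (hsq k).mono fun t ht => ⟨by linarith [ht.2], by linarith [ht.1]⟩
    · rw [integral_sub (integrable_const _) (hsqint k), ← hσ2 k]
      simp
  have hcube : ∀ᵐ z ∂(Measure.pi ν), ∀ k, z k ∈ Set.Icc (0 : ℝ) 1 :=
    ae_all_iff.mpr fun k => (measurePreserving_eval ν k).quasiMeasurePreserving.ae (hIcc k)
  -- Deviation of the inner product with a fixed point of the cube.
  have hinner : ∀ᵐ z ∂(Measure.pi ν),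
      Measure.pi ν {y | R0sq / 2 ≤ ∑ k, (y k - m k) * (z k - m k)} ≤ ENNReal.ofReal e := by
    filter_upwards [hcube] with z hz
    refine pi_measure_sum_ge_le ν (f := fun k t => (t - m k) * (z k - m k))
      (fun k => by fun_prop) (fun k => ?_) (fun k => ?_) (by positivity)
    · obtain ⟨a, ha⟩ := exists_mul_sub_mem_Icc (m := m k) (w := z k - m k)
        (abs_le.mpr ⟨by linarith [(hz k).1, (hm01 k).2], by linarith [(hz k).2, (hm01 k).1]⟩)
      exact ⟨a, (hIcc k).mono ha⟩
    · rw [integral_mul_const, integral_sub (hint k) (integrable_const _), ← hm k]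
      simp
  set P : Measure (Fin M → Fin n → ℝ) := Measure.pi fun _ : Fin M => Measure.pi ν with hP
  set U : Fin M → Set (Fin M → Fin n → ℝ) := fun j =>
    {x | R0sq / 2 ≤ ∑ k, ((x j k - m k) ^ 2 - σ2 k)} with hU
  set L : Fin M → Set (Fin M → Fin n → ℝ) := fun j =>
    {x | R0sq / 2 ≤ ∑ k, (σ2 k - (x j k - m k) ^ 2)} with hL
  set C : Fin M → Set (Fin M → Fin n → ℝ) := fun i =>
    {x | i ≠ lst ∧ R0sq / 2 ≤ ∑ k, (x i k - m k) * (x lst k - m k)} with hC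
  have hPU : ∀ j, P (U j) ≤ ENNReal.ofReal e := fun j => by
    have hmeas : MeasurableSet {y : Fin n → ℝ | R0sq / 2 ≤ ∑ k, ((y k - m k) ^ 2 - σ2 k)} :=
      measurableSet_le (by fun_prop) (by fun_prop)
    exact ((measurePreserving_eval (fun _ : Fin M => Measure.pi ν) j).measure_preimage
      hmeas.nullMeasurableSet).trans_le hup
  have hPL : ∀ j, P (L j) ≤ ENNReal.ofReal e := fun j => by
    have hmeas : MeasurableSet {y : Fin n → ℝ | R0sq / 2 ≤ ∑ k, (σ2 k - (y k - m k) ^ 2)} :=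
      measurableSet_le (by fun_prop) (by fun_prop)
    exact ((measurePreserving_eval (fun _ : Fin M => Measure.pi ν) j).measure_preimage
      hmeas.nullMeasurableSet).trans_le hlow
  have hPC : ∀ i, P (C i) ≤ ENNReal.ofReal e := fun i => by
    by_cases hi : i = lst
    · simp [hC, hi]
    · refine (measure_mono fun x hx => hx.2).trans (pi_measure_pair_le (Measure.pi ν) hi
        (A := {p | R0sq / 2 ≤ ∑ k, (p.2 k - m k) * (p.1 k - m k)})
        (measurableSet_le (by fun_prop) (by fun_prop)) hinner)
  set G : Set (Fin M → Fin n → ℝ) := {x |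
        (∀ j, 1 / 2 ≤ (∑ k, (x j k - m k) ^ 2) / R0sq ∧
              (∑ k, (x j k - m k) ^ 2) / R0sq ≤ 3 / 2) ∧
        ∀ i, i ≠ lst →
          (∑ k, ((x i k - m k) / Real.sqrt R0sq) *
              ((x lst k - m k) / Real.sqrt (∑ k', (x lst k' - m k') ^ 2)))
            < Real.sqrt 2 / 2} with hG
  have hsub : Gᶜ ⊆ ⋃ j, (U j ∪ L j ∪ C j) := by
    intro x hx
    by_contra hcon
    simp only [Set.mem_iUnion, Set.mem_union, not_exists, not_or] at hcon
    have hnorm : ∀ j, 1 / 2 ≤ (∑ k, (x j k - m k) ^ 2) / R0sq ∧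
        (∑ k, (x j k - m k) ^ 2) / R0sq ≤ 3 / 2 := by
      intro j
      obtain ⟨⟨h1, h2⟩, -⟩ := hcon j
      simp only [hU, hL, Set.mem_ofPred_eq, not_le, Finset.sum_sub_distrib, ← hR0] at h1 h2
      rw [le_div_iff₀ hRpos, div_le_iff₀ hRpos]
      constructor <;> linarith
    refine hx ⟨hnorm, fun i hi => ?_⟩
    by_contra hle
    exact (hcon i).2 ⟨hi, half_le_sum_mul_of_le_normalized hRpos (hnorm lst).1 (not_lt.mp hle)⟩
  have hexp : M * (3 * e) < ϑ := by
    have h1 : e ≤ Real.exp (-(0.5 * n * σ0sq ^ 2)) := by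
      refine Real.exp_le_exp.mpr (neg_le_neg ?_)
      rw [le_div_iff₀ hnpos]
      nlinarith [mul_pos hnpos hσ0pos]
    have h2 : M * (3 * e) ≤ M * (3 * Real.exp (-(0.5 * n * σ0sq ^ 2))) := by gcongr
    refine h2.trans_lt ?_
    rw [Real.exp_neg, ← div_eq_mul_inv, mul_div_assoc', div_lt_iff₀ (Real.exp_pos _)]
    linarith
  have hbad : P Gᶜ < ENNReal.ofReal ϑ := by
    calc P Gᶜ ≤ P (⋃ j, (U j ∪ L j ∪ C j)) := measure_mono hsub
      _ ≤ ∑ j, P (U j ∪ L j ∪ C j) := measure_iUnion_fintype_le _ _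
      _ ≤ ∑ _j : Fin M, ENNReal.ofReal (3 * e) := by
        refine Finset.sum_le_sum fun j _ => ?_
        rw [show 3 * e = e + e + e by ring, ENNReal.ofReal_add (by positivity) (by positivity),
          ENNReal.ofReal_add (by positivity) (by positivity)]
        exact (measure_union_le _ _).trans (add_le_add ((measure_union_le _ _).trans
          (add_le_add (hPU j) (hPL j))) (hPC j))
      _ = ENNReal.ofReal (M * (3 * e)) := by
        rw [ENNReal.ofReal_mul (by positivity)]
        simp
      _ < ENNReal.ofReal ϑ := (ENNReal.ofReal_lt_ofReal_iff hϑ0).mpr hexp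
  by_contra hle
  have hone : (1 : ENNReal) ≤ P G + P Gᶜ := by
    rw [← measure_univ (μ := P), ← Set.union_compl_self G]
    exact measure_union_le _ _
  have hlt : P G + P Gᶜ < ENNReal.ofReal (1 - ϑ) + ENNReal.ofReal ϑ :=
    ENNReal.add_lt_add_of_le_of_lt (ne_top_of_le_ne_top ENNReal.ofReal_ne_top (not_lt.mp hle))
      (not_lt.mp hle) hbad
  rw [← ENNReal.ofReal_add (by linarith) hϑ0.le, sub_add_cancel, ENNReal.ofReal_one] at hlt
  exact absurd hone (not_le.mpr hlt)
end
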